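/- arXiv:1507.01104 — 4 statements merged into one kernel-verified Lean document; each statement's English description precedes it below -/
import Mathlib

section
/- Let ν ∈ (-1, 8) and let α_{ν,1} be the smallest positive zero of 𝒟_ν. Then 𝒟_ν(x) ≤ ((α_{ν,1}² - x²)/(α_{ν,1}² + x²))^{m_ν} for all x ∈ (-α_{ν,1}, α_{ν,1}), where m_ν = 3α_{ν,1}²/(8(ν+1)). Moreover m_ν is the best possible exponent: for every m > m_ν there exists x ∈ (-α_{ν,1}, α_{ν,1}) with 𝒟_ν(x) > ((α_{ν,1}² - x²)/(α_{ν,1}² + x²))^m. -/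
open Real Set

/-- Bessel function of the first kind `J_ν(x)` (series definition, intended for `x > 0`). -/
noncomputable def besselJ (ν x : ℝ) : ℝ :=
  ∑' n : ℕ, (-1 : ℝ) ^ n * (x / 2) ^ (ν + 2 * (n : ℝ)) /
    ((n.factorial : ℝ) * Real.Gamma (ν + n + 1))

/-- Modified Bessel function of the first kind `I_ν(x)` (series definition, for `x > 0`). -/
noncomputable def besselI (ν x : ℝ) : ℝ :=
  ∑' n : ℕ, (x / 2) ^ (ν + 2 * (n : ℝ)) /
    ((n.factorial : ℝ) * Real.Gamma (ν + n + 1))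

/-- The cross-product `W_ν(x) = J_{ν+1}(x) I_ν(x) + J_ν(x) I_{ν+1}(x)`. -/
noncomputable def crossW (ν x : ℝ) : ℝ :=
  besselJ (ν + 1) x * besselI ν x + besselJ ν x * besselI (ν + 1) x

/-- The normalized cross-product `𝒲_ν`, an even entire function of `x`. -/
noncomputable def Wcal (ν x : ℝ) : ℝ :=
  ∑' n : ℕ, (-1 : ℝ) ^ n * (Real.Gamma (ν + 1) * Real.Gamma (ν + 2)) * x ^ (4 * n) /
    ((2 : ℝ) ^ (4 * n) * (n.factorial : ℝ) * Real.Gamma (ν + n + 1) * Real.Gamma (ν + 2 * n + 2))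

/-- The normalized Dini function `𝒟_ν`. -/
noncomputable def Dcal (ν x : ℝ) : ℝ :=
  ∑' n : ℕ, (-1 : ℝ) ^ n * (2 * (n : ℝ) + 1) * Real.Gamma (ν + 1) * x ^ (2 * n) /
    ((2 : ℝ) ^ (2 * n) * (n.factorial : ℝ) * Real.Gamma (ν + n + 1))

/-- The normalized modified Dini function `λ_ν`. -/
noncomputable def lamDini (ν x : ℝ) : ℝ :=
  ∑' n : ℕ, (2 * (n : ℝ) + 1) * Real.Gamma (ν + 1) * x ^ (2 * n) /
    ((2 : ℝ) ^ (2 * n) * (n.factorial : ℝ) * Real.Gamma (ν + n + 1))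

/-- The normalized Bessel function `𝒥_ν`. -/
noncomputable def Jcal (ν x : ℝ) : ℝ :=
  ∑' n : ℕ, (-1 : ℝ) ^ n * Real.Gamma (ν + 1) * x ^ (2 * n) /
    ((2 : ℝ) ^ (2 * n) * (n.factorial : ℝ) * Real.Gamma (ν + n + 1))

/-- The normalized modified Bessel function `𝓘_ν`. -/
noncomputable def Ical (ν x : ℝ) : ℝ :=
  ∑' n : ℕ, Real.Gamma (ν + 1) * x ^ (2 * n) /
    ((2 : ℝ) ^ (2 * n) * (n.factorial : ℝ) * Real.Gamma (ν + n + 1))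

/-- A function is absolutely monotonic on a set if it is infinitely differentiable there and
all of its (iterated) derivatives are nonnegative there. -/
def AbsolutelyMonotonicOn (f : ℝ → ℝ) (s : Set ℝ) : Prop :=
  ContDiffOn ℝ (⊤ : ℕ∞) f s ∧ ∀ (k : ℕ), ∀ x ∈ s, 0 ≤ iteratedDerivWithin k f s x


section DiniAux
open Polynomial

/-- All complex zeros are positive reals. -/
def PosRoots (p : ℝ[X]) : Prop :=
  ∀ w : ℂ, (p.map (algebraMap ℝ ℂ)).eval w = 0 → w.im = 0 ∧ 0 < w.re

lemma im_sum_aux (w : ℂ) (R : Multiset ℂ) (hR : ∀ b ∈ R, b.im = 0 ∧ 0 < b.re) :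
    w.im * ((R.map fun z => 1 / (w - z)).sum).im ≤ 0 := by
  induction R using Multiset.induction with
  | empty => simp
  | cons b R ih =>
    have h1 := ih (fun z hz => hR z (Multiset.mem_cons_of_mem hz))
    obtain ⟨hb, -⟩ := hR b (Multiset.mem_cons_self b R)
    have h2 : w.im * (1 / (w - b)).im ≤ 0 := by
      rw [one_div, Complex.inv_im, Complex.sub_im, hb, sub_zero]
      have : w.im * (-w.im / Complex.normSq (w - b)) = -(w.im ^ 2 / Complex.normSq (w - b)) := by
        ring
      rw [this]
      have := div_nonneg (sq_nonneg w.im) (Complex.normSq_nonneg (w - b))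
      linarith
    rw [Multiset.map_cons, Multiset.sum_cons, Complex.add_im]
    linarith

lemma re_sum_aux (w : ℂ) (hw : w.re < 0) (R : Multiset ℂ) (hR : ∀ b ∈ R, b.im = 0 ∧ 0 < b.re) :
    ((R.map fun z => 1 / (w - z)).sum).re ≤ 0 := by
  induction R using Multiset.induction with
  | empty => simp
  | cons b R ih =>
    have h1 := ih (fun z hz => hR z (Multiset.mem_cons_of_mem hz))
    obtain ⟨-, hb⟩ := hR b (Multiset.mem_cons_self b R)
    have h2 : (1 / (w - b)).re ≤ 0 := by
      rw [one_div, Complex.inv_re, Complex.sub_re]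
      exact div_nonpos_of_nonpos_of_nonneg (by linarith) (Complex.normSq_nonneg (w - b))
    rw [Multiset.map_cons, Multiset.sum_cons, Complex.add_re]
    linarith

lemma PosRoots.op {p : ℝ[X]} (hp : PosRoots p) {c s : ℝ} (hc : 0 < c) (hs : 0 ≤ s) :
    PosRoots (C c * p - C s * X * p + X * derivative p) := by
  intro w hw
  set P := p.map (algebraMap ℝ ℂ) with hP
  by_cases h0 : P.eval w = 0
  · exact hp w h0
  have hP0 : P ≠ 0 := by rintro h; simp [h] at h0
  have hR : ∀ b ∈ P.roots, b.im = 0 ∧ 0 < b.re := fun b hb =>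
    hp b ((mem_roots hP0).1 hb)
  have hld := (IsAlgClosed.splits P).eval_derivative_div_eval_of_ne_zero h0
  set S := (P.roots.map fun z => 1 / (w - z)).sum with hS
  have hw' : (c : ℂ) * P.eval w - s * w * P.eval w + w * P.derivative.eval w = 0 := by
    simpa [hP, derivative_map] using hw
  have hd : P.derivative.eval w = S * P.eval w := by rw [← hld]; field_simp
  have hw0 : w ≠ 0 := by
    rintro rfl
    simp at hw'
    rcases hw' with h | h
    · exact hc.ne' h
    · exact h0 h
  have key : (c : ℂ) * w⁻¹ - s + S = 0 := by
    rw [hd] at hw'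
    have : (w * P.eval w) * ((c : ℂ) * w⁻¹ - s + S) = 0 := by
      rw [← hw']; field_simp
    exact (mul_eq_zero.1 this).resolve_left (mul_ne_zero hw0 h0)
  have hn : 0 < Complex.normSq w := Complex.normSq_pos.2 hw0
  have him : w.im = 0 := by
    by_contra hne
    have h1 := congrArg Complex.im key
    simp only [Complex.add_im, Complex.sub_im, Complex.mul_im, Complex.ofReal_re,
      Complex.ofReal_im, Complex.inv_im, Complex.zero_im] at h1
    have h2 := im_sum_aux w P.roots hR
    rw [← hS] at h2
    have h3 : w.im * (c * (-w.im / Complex.normSq w)) = -(c * (w.im ^ 2 / Complex.normSq w)) := by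
      ring
    have h4 : 0 < c * (w.im ^ 2 / Complex.normSq w) := by positivity
    have h5 : S.im = - (c * (-w.im / Complex.normSq w)) := by linarith
    rw [h5] at h2
    linarith
  refine ⟨him, ?_⟩
  by_contra hle
  have hre : w.re < 0 := by
    rcases lt_or_eq_of_le (not_lt.1 hle) with h | h
    · exact h
    · exact absurd (Complex.ext h him) hw0
  have h1 := congrArg Complex.re key
  simp only [Complex.add_re, Complex.sub_re, Complex.mul_re, Complex.ofReal_re,
      Complex.ofReal_im, Complex.inv_re, Complex.zero_re, zero_mul, sub_zero] at h1
  have h2 := re_sum_aux w hre P.roots hR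
  rw [← hS] at h2
  have h3 : c * (w.re / Complex.normSq w) < 0 :=
    mul_neg_of_pos_of_neg hc (div_neg_of_neg_of_pos hre hn)
  linarith

/-- Coefficients of the rescaled Laguerre polynomials. -/
noncomputable def lagC (ν s : ℝ) (N n : ℕ) : ℝ :=
  (N.choose n : ℝ) * (-s) ^ n * (Real.Gamma (ν + 1) / Real.Gamma (ν + n + 1))

noncomputable def lagP (ν s : ℝ) (N : ℕ) : ℝ[X] :=
  ∑ n ∈ Finset.range (N + 1), monomial n (lagC ν s N n)

lemma coeff_lagP (ν s : ℝ) (N n : ℕ) : (lagP ν s N).coeff n = lagC ν s N n := by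
  simp only [lagP, finsetSum_coeff, coeff_monomial]
  rw [Finset.sum_ite_eq']
  split_ifs with h
  · rfl
  · have : N < n := by simpa using h
    simp [lagC, Nat.choose_eq_zero_of_lt this]

lemma lagP_succ {ν : ℝ} (hν : -1 < ν) (s : ℝ) (N : ℕ) :
    C (ν + 1) * lagP (ν + 1) s N - C s * X * lagP (ν + 1) s N + X * derivative (lagP (ν + 1) s N)
      = C (ν + 1) * lagP ν s (N + 1) := by
  ext n
  have g1 : Real.Gamma (ν + 1 + 1) = (ν + 1) * Real.Gamma (ν + 1) :=
    Real.Gamma_add_one (by linarith)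
  have hg : 0 < Real.Gamma (ν + 1) := Real.Gamma_pos_of_pos (by linarith)
  rcases n with _ | n
  · simp [coeff_lagP, lagC, mul_assoc, g1]
    left
    have : ν + 1 ≠ 0 := by linarith
    field_simp
  · simp only [coeff_add, coeff_sub, coeff_C_mul, mul_assoc, coeff_X_mul, coeff_derivative,
      coeff_lagP, lagC]
    have hpos : 0 < ν + n + 2 := by have : (0:ℝ) ≤ n := n.cast_nonneg; linarith
    have e1 : ν + 1 + ((n + 1 : ℕ) : ℝ) + 1 = (ν + n + 2) + 1 := by push_cast; ring
    have e2 : ν + 1 + (n : ℝ) + 1 = ν + n + 2 := by ring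
    have e3 : ν + ((n + 1 : ℕ) : ℝ) + 1 = ν + n + 2 := by push_cast; ring
    rw [e1, e2, e3, Real.Gamma_add_one hpos.ne', g1, Nat.choose_succ_succ]
    have hg2 : 0 < Real.Gamma (ν + n + 2) := Real.Gamma_pos_of_pos hpos
    push_cast
    field_simp
    ring

lemma posRoots_lagP (s : ℝ) (hs : 0 ≤ s) (N : ℕ) : ∀ ν : ℝ, -1 < ν → PosRoots (lagP ν s N) := by
  induction N with
  | zero =>
    intro ν hν w hw
    have hg : 0 < Real.Gamma (ν + 1) := Real.Gamma_pos_of_pos (by linarith)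
    simp [lagP, lagC, hg.ne'] at hw
  | succ N ih =>
    intro ν hν w hw
    refine PosRoots.op (ih (ν + 1) (by linarith)) (c := ν + 1) (s := s) (by linarith) hs w ?_
    rw [lagP_succ hν, Polynomial.map_mul, eval_mul, hw, mul_zero]

/-- Polynomial approximants of the Dini function in the variable `x ^ 2`. -/
noncomputable def dinP (ν : ℝ) (N : ℕ) : ℝ[X] :=
  C 2 * (C (1 / 2) * lagP ν (1 / (4 * N)) N - C 0 * X * lagP ν (1 / (4 * N)) N
    + X * derivative (lagP ν (1 / (4 * N)) N))

lemma posRoots_dinP {ν : ℝ} (hν : -1 < ν) (N : ℕ) : PosRoots (dinP ν N) := by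
  intro w hw
  refine PosRoots.op (posRoots_lagP (1 / (4 * N)) (by positivity) N ν hν)
    (c := 1 / 2) (s := 0) (by norm_num) le_rfl w ?_
  rw [dinP, Polynomial.map_mul, eval_mul] at hw
  refine (mul_eq_zero.1 hw).resolve_left ?_
  simp

lemma coeff_dinP (ν : ℝ) (N n : ℕ) :
    (dinP ν N).coeff n = (2 * n + 1) * lagC ν (1 / (4 * N)) N n := by
  rw [dinP]
  rcases n with _ | n
  · simp [coeff_lagP]
  · simp only [coeff_add, coeff_sub, coeff_C_mul, mul_assoc, coeff_X_mul, coeff_derivative,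
      coeff_lagP]
    push_cast
    ring

lemma exists_factor {q : ℝ[X]} (hq : PosRoots q) (h0 : q.coeff 0 = 1) :
    ∃ T : Multiset ℝ, (∀ t ∈ T, 0 < t) ∧ q = (T.map fun t => 1 - C t * X).prod := by
  set P := q.map (algebraMap ℝ ℂ) with hP
  have hP0 : P.eval 0 = 1 := by
    rw [← coeff_zero_eq_eval_zero, hP, coeff_map, h0]; simp
  have hPne : P ≠ 0 := by rintro h; simp [h] at hP0
  have hR : ∀ b ∈ P.roots, b.im = 0 ∧ 0 < b.re := fun b hb =>
    hq b ((mem_roots hPne).1 hb)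
  have hgen : ∀ R : Multiset ℂ, (∀ b ∈ R, b.im = 0 ∧ 0 < b.re) →
      (R.map fun b => (X : ℂ[X]) - C b).prod = C ((R.map fun b => -b).prod) *
        ((R.map fun b => (b.re)⁻¹).map fun t : ℝ => (1 : ℂ[X]) - C (t : ℂ) * X).prod := by
    intro R
    induction R using Multiset.induction with
    | empty => simp
    | cons b R ih =>
      intro h
      obtain ⟨hb, hb'⟩ := h b (Multiset.mem_cons_self b R)
      have e : b = (b.re : ℂ) := Complex.ext (by simp) (by simp [hb])
      have e2 : (X : ℂ[X]) - C b = C (-b) * (1 - C ((b.re⁻¹ : ℝ) : ℂ) * X) := by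
        have hbne : b ≠ 0 := by rintro rfl; simp at hb'
        have : -b * ((b.re⁻¹ : ℝ) : ℂ) = -1 := by
          rw [Complex.ofReal_inv, ← e]; field_simp
        rw [mul_sub, ← mul_assoc, ← C_mul, this]
        simp; ring
      simp only [Multiset.map_cons, Multiset.prod_cons, C_mul]
      rw [ih (fun z hz => h z (Multiset.mem_cons_of_mem hz)), e2]
      ring
  refine ⟨P.roots.map fun b => (b.re)⁻¹, ?_, ?_⟩
  · intro t ht
    obtain ⟨b, hb, rfl⟩ := Multiset.mem_map.1 ht
    exact inv_pos.2 (hR b hb).2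
  · have h1 := (IsAlgClosed.splits P).eq_prod_roots
    rw [hgen P.roots hR, ← mul_assoc, ← C_mul] at h1
    set T := P.roots.map fun b => (b.re)⁻¹ with hT
    have h2 : ((T.map fun t : ℝ => (1 : ℂ[X]) - C (t : ℂ) * X).prod).eval 0 = 1 := by
      simp [eval_multiset_prod]
    have h3 : P.leadingCoeff * (P.roots.map fun b => -b).prod = 1 := by
      have := congrArg (eval 0) h1
      rw [hP0, eval_mul, h2, eval_C, mul_one] at this
      exact this.symm
    rw [h3, C_1, one_mul] at h1
    apply Polynomial.map_injective (algebraMap ℝ ℂ) (algebraMap ℝ ℂ).injective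
    rw [← hP, Polynomial.map_multiset_prod, Multiset.map_map]
    refine h1.trans ?_
    congr 1
    apply Multiset.map_congr rfl
    intro t _
    simp

lemma prod_coeffs (T : Multiset ℝ) :
    ((T.map fun t => 1 - C t * X).prod).coeff 0 = 1 ∧
    ((T.map fun t => 1 - C t * X).prod).coeff 1 = - T.sum ∧
    2 * ((T.map fun t => 1 - C t * X).prod).coeff 2 = T.sum ^ 2 - (T.map fun t => t ^ 2).sum := by
  induction T using Multiset.induction with
  | empty => simp [coeff_one]
  | cons a T ih =>
    obtain ⟨h0, h1, h2⟩ := ih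
    simp only [Multiset.map_cons, Multiset.prod_cons, Multiset.sum_cons, sub_mul, one_mul,
      mul_assoc, coeff_sub, coeff_C_mul, coeff_X_mul, coeff_X_mul_zero]
    refine ⟨by rw [h0]; ring, by rw [h1, h0]; ring, ?_⟩
    rw [mul_sub, h2, h1]; ring

lemma prod_upper (t1 z : ℝ) (ht1 : 0 < t1) (hz : 0 ≤ z) (hz1 : t1 * z < 1) (T : Multiset ℝ)
    (hT : ∀ t ∈ T, 0 < t ∧ t ≤ t1) :
    0 ≤ (T.map fun t => 1 - t * z).prod ∧
    (T.map fun t => 1 - t * z).prod ≤ (1 + t1 * z) ^ (-(T.sum / t1)) ∧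
    (1 - t1 * z) ^ (T.sum / t1) ≤ (T.map fun t => 1 - t * z).prod := by
  have hp : 0 < 1 + t1 * z := by positivity
  have hm : 0 < 1 - t1 * z := by linarith
  induction T using Multiset.induction with
  | empty => simp
  | cons a T ih =>
    obtain ⟨h0, h1, h2⟩ := ih (fun t ht => hT t (Multiset.mem_cons_of_mem ht))
    obtain ⟨ha, hat⟩ := hT a (Multiset.mem_cons_self a T)
    have haz : 0 < 1 - a * z := by nlinarith
    simp only [Multiset.map_cons, Multiset.prod_cons, Multiset.sum_cons]
    have hr0 : 0 ≤ a / t1 := by positivity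
    have hr1 : a / t1 ≤ 1 := (div_le_one ht1).2 hat
    have e : a / t1 * (t1 * z) = a * z := by field_simp
    refine ⟨mul_nonneg haz.le h0, ?_, ?_⟩
    · rw [add_div, neg_add, Real.rpow_add hp]
      refine mul_le_mul ?_ h1 h0 (by positivity)
      have b := rpow_one_add_le_one_add_mul_self (s := t1 * z) (by linarith) hr0 hr1
      rw [e] at b
      rw [Real.rpow_neg hp.le]
      have hq : 0 < (1 + t1 * z) ^ (a / t1) := by positivity
      rw [le_inv_comm₀ haz hq]
      refine b.trans ?_
      rw [← one_div, le_div_iff₀ haz]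
      nlinarith [sq_nonneg (a * z)]
    · rw [add_div, Real.rpow_add hm]
      refine mul_le_mul ?_ h2 (by positivity) haz.le
      have b := rpow_one_add_le_one_add_mul_self (s := -(t1 * z)) (by linarith) hr0 hr1
      rw [mul_neg, e] at b
      simpa [sub_eq_add_neg] using b

lemma sum_sq_le (t1 : ℝ) (T : Multiset ℝ) (hT : ∀ t ∈ T, 0 < t ∧ t ≤ t1) :
    (T.map fun t => t ^ 2).sum ≤ t1 * T.sum := by
  induction T using Multiset.induction with
  | empty => simp
  | cons a T ih =>
    have h := ih (fun t ht => hT t (Multiset.mem_cons_of_mem ht))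
    obtain ⟨ha, hat⟩ := hT a (Multiset.mem_cons_self a T)
    simp only [Multiset.map_cons, Multiset.sum_cons]
    nlinarith

lemma sum_nonneg_aux (T : Multiset ℝ) (hT : ∀ t ∈ T, 0 < t) : 0 ≤ T.sum :=
  Multiset.sum_nonneg fun t ht => (hT t ht).le

lemma dinP_main {ν : ℝ} (hν : -1 < ν) {N : ℕ} (hN : 1 ≤ N) :
    ∃ t1 : ℝ, 0 < t1 ∧ (dinP ν N).eval (1 / t1) = 0 ∧ t1 ≤ 3 / (4 * (ν + 1)) ∧
      (4 * ν + 13) / (16 * (ν + 1) ^ 2 * (ν + 2)) ≤ t1 * (3 / (4 * (ν + 1))) ∧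
      ∀ z : ℝ, 0 ≤ z → t1 * z < 1 →
        (dinP ν N).eval z ≤
          (1 - t1 * z) * (1 + t1 * z) ^ (-(3 / (4 * (ν + 1)) / t1 - 1)) ∧
        (1 - t1 * z) ^ (3 / (4 * (ν + 1)) / t1) ≤ (dinP ν N).eval z := by
  have hν1 : 0 < ν + 1 := by linarith
  have hν2 : 0 < ν + 2 := by linarith
  have hN0 : (0 : ℝ) < N := by exact_mod_cast hN
  have hg : 0 < Real.Gamma (ν + 1) := Real.Gamma_pos_of_pos hν1
  have g1 : Real.Gamma (ν + 1 + 1) = (ν + 1) * Real.Gamma (ν + 1) :=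
    Real.Gamma_add_one hν1.ne'
  have g2 : Real.Gamma (ν + 2 + 1) = (ν + 2) * ((ν + 1) * Real.Gamma (ν + 1)) := by
    rw [Real.Gamma_add_one hν2.ne', ← g1]; congr 2; ring
  have c0 : (dinP ν N).coeff 0 = 1 := by
    rw [coeff_dinP]; simp [lagC, hg.ne']
  have c1 : (dinP ν N).coeff 1 = -(3 / (4 * (ν + 1))) := by
    rw [coeff_dinP]; simp only [lagC, Nat.choose_one_right, Nat.cast_one, g1]
    field_simp; ring
  have c2 : 2 * (dinP ν N).coeff 2 = 5 * (1 - 1 / N) / (16 * (ν + 1) * (ν + 2)) := by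
    rw [coeff_dinP]; simp only [lagC, Nat.cast_choose_two, Nat.cast_ofNat, g2]
    field_simp; ring
  obtain ⟨T, hT, hq⟩ := exists_factor (posRoots_dinP hν N) c0
  obtain ⟨-, d1, d2⟩ := prod_coeffs T
  rw [← hq] at d1 d2
  have hsum : T.sum = 3 / (4 * (ν + 1)) := by linarith
  have hs0 : 0 < 3 / (4 * (ν + 1)) := by positivity
  have hne : T ≠ 0 := by
    rintro rfl
    simp at hsum
    linarith
  obtain ⟨t1, ht1, hmax⟩ := Multiset.exists_max_image (fun t : ℝ => t) hne
  have hpos := hT t1 ht1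
  have hT2 : ∀ t ∈ T, 0 < t ∧ t ≤ t1 := fun t ht => ⟨hT t ht, hmax t ht⟩
  have hev : ∀ z, (dinP ν N).eval z = (T.map fun t => 1 - t * z).prod := by
    intro z
    rw [hq, eval_multiset_prod, Multiset.map_map]
    congr 1
    apply Multiset.map_congr rfl
    intro t _
    simp
  obtain ⟨T', rfl⟩ := Multiset.exists_cons_of_mem ht1
  have hsum' : T'.sum = 3 / (4 * (ν + 1)) - t1 := by
    rw [← hsum, Multiset.sum_cons]; ring
  have hT' : ∀ t ∈ T', 0 < t ∧ t ≤ t1 := fun t ht => hT2 t (Multiset.mem_cons_of_mem ht)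
  refine ⟨t1, hpos, ?_, ?_, ?_, ?_⟩
  · rw [hev, Multiset.map_cons, Multiset.prod_cons, mul_one_div_cancel hpos.ne']; simp
  · have := sum_nonneg_aux T' (fun t ht => (hT' t ht).1)
    linarith
  · have h := sum_sq_le t1 _ hT2
    rw [hsum] at h
    rw [hsum, c2] at d2
    have h3 : 5 * (1 - 1 / N) / (16 * (ν + 1) * (ν + 2)) ≤ 5 * 1 / (16 * (ν + 1) * (ν + 2)) := by
      have : (0:ℝ) ≤ 1 / N := by positivity
      gcongr
      linarith
    have h4 : (4 * ν + 13) / (16 * (ν + 1) ^ 2 * (ν + 2))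
        = (3 / (4 * (ν + 1))) ^ 2 - 5 * 1 / (16 * (ν + 1) * (ν + 2)) := by
      field_simp; ring
    linarith
  · intro z hz hz1
    refine ⟨?_, ?_⟩
    · obtain ⟨-, h, -⟩ := prod_upper t1 z hpos hz hz1 T' hT'
      rw [hev, Multiset.map_cons, Multiset.prod_cons]
      rw [hsum', sub_div, div_self hpos.ne'] at h
      exact mul_le_mul_of_nonneg_left h (by linarith)
    · obtain ⟨-, -, h⟩ := prod_upper t1 z hpos hz hz1 _ hT2
      rw [hev, ← hsum]
      exact h

lemma gamma_ratio_bound {ν : ℝ} (hν : -1 < ν) (n : ℕ) :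
    0 ≤ Real.Gamma (ν + 1) / Real.Gamma (ν + n + 1) ∧
    Real.Gamma (ν + 1) / Real.Gamma (ν + n + 1) ≤ 1 + 1 / (ν + 1) := by
  have hν1 : 0 < ν + 1 := by linarith
  have hg : 0 < Real.Gamma (ν + 1) := Real.Gamma_pos_of_pos hν1
  have hgn : ∀ n : ℕ, 0 < Real.Gamma (ν + n + 1) := fun n =>
    Real.Gamma_pos_of_pos (by have : (0:ℝ) ≤ n := n.cast_nonneg; linarith)
  refine ⟨(div_pos hg (hgn n)).le, ?_⟩
  rcases n with _ | n
  · simp [hg.ne']; linarith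
  have : Real.Gamma (ν + 1) / Real.Gamma (ν + (n + 1 : ℕ) + 1) ≤ 1 / (ν + 1) := by
    rw [div_le_div_iff₀ (hgn _) hν1, one_mul]
    induction n with
    | zero => simp; rw [Real.Gamma_add_one hν1.ne', mul_comm]
    | succ n ih =>
      refine ih.trans ?_
      have hp : 0 < ν + ((n + 1 : ℕ) : ℝ) + 1 := by
        push_cast; have : (0:ℝ) ≤ n := n.cast_nonneg; linarith
      have e : ν + ((n + 1 + 1 : ℕ) : ℝ) + 1 = (ν + ((n + 1 : ℕ) : ℝ) + 1) + 1 := by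
        push_cast; ring
      rw [e, Real.Gamma_add_one hp.ne']
      have := hgn (n + 1)
      have h1 : 1 ≤ ν + ((n + 1 : ℕ) : ℝ) + 1 := by
        push_cast; have : (0:ℝ) ≤ n := n.cast_nonneg; linarith
      nlinarith
  linarith

lemma choose_ratio_tendsto (n : ℕ) {φ : ℕ → ℕ} (hφ : Filter.Tendsto φ Filter.atTop Filter.atTop) :
    Filter.Tendsto (fun k => ((φ k).choose n : ℝ) * (-(1 / (4 * (φ k : ℝ)))) ^ n) Filter.atTop
      (nhds ((-1) ^ n / (4 ^ n * n.factorial))) := by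
  have h1 := isEquivalent_choose n
  have h2 : Filter.Tendsto (fun N : ℕ => (N.choose n : ℝ) / ((N : ℝ) ^ n / n.factorial))
      Filter.atTop (nhds 1) := by
    refine (Asymptotics.isEquivalent_iff_tendsto_one ?_).1 h1
    filter_upwards [Filter.eventually_gt_atTop 0] with N hN
    positivity
  have h3 := (h2.comp hφ).mul_const ((-1 : ℝ) ^ n / (4 ^ n * n.factorial))
  rw [one_mul] at h3
  refine h3.congr' ?_
  filter_upwards [hφ.eventually_gt_atTop 0] with k hk
  have : (0 : ℝ) < φ k := by exact_mod_cast hk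
  simp only [Function.comp]
  rw [neg_pow (1 / (4 * (φ k : ℝ))), one_div, inv_pow, mul_pow]
  field_simp

lemma dinP_tendsto {ν : ℝ} (hν : -1 < ν) {φ : ℕ → ℕ}
    (hφ : Filter.Tendsto φ Filter.atTop Filter.atTop) (z : ℕ → ℝ) (x : ℝ)
    (hz : Filter.Tendsto z Filter.atTop (nhds (x ^ 2))) :
    Filter.Tendsto (fun k => (dinP ν (φ k)).eval (z k)) Filter.atTop (nhds (Dcal ν x)) := by
  have hev : ∀ N y, (dinP ν N).eval y
      = ∑' n : ℕ, (2 * n + 1) * lagC ν (1 / (4 * N)) N n * y ^ n := by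
    intro N y
    rw [eval_eq_sum_range' (n := (dinP ν N).natDegree + 1) (Nat.lt_succ_self _),
      tsum_eq_sum (s := Finset.range ((dinP ν N).natDegree + 1))]
    · exact Finset.sum_congr rfl fun n _ => by rw [coeff_dinP]
    · intro n hn
      rw [← coeff_dinP, coeff_eq_zero_of_natDegree_lt, zero_mul]
      simpa [Nat.lt_succ_iff] using hn
  simp only [hev]
  unfold Dcal
  set B := x ^ 2 + 1 with hB
  set K := 1 + 1 / (ν + 1) with hK
  have hν1 : 0 < ν + 1 := by linarith
  refine tendsto_tsum_of_dominated_convergence (bound := fun n => K * (B ^ n / n.factorial)) ?_ ?_ ?_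
  · exact (Real.summable_pow_div_factorial B).mul_left K
  · intro n
    have h := ((choose_ratio_tendsto n hφ).mul_const
      ((2 * n + 1) * (Real.Gamma (ν + 1) / Real.Gamma (ν + n + 1)))).mul (hz.pow n)
    have hgn : 0 < Real.Gamma (ν + n + 1) :=
      Real.Gamma_pos_of_pos (by have : (0:ℝ) ≤ n := n.cast_nonneg; linarith)
    convert h using 1
    · funext k
      simp only [lagC]; ring
    · congr 1
      have : (2 : ℝ) ^ (2 * n) = 4 ^ n := by rw [pow_mul]; norm_num
      rw [this, pow_mul]
      field_simp
  · have hb : ∀ᶠ k in Filter.atTop, |z k| ≤ B := by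
      have h1 : Filter.Tendsto (fun k => |z k|) Filter.atTop (nhds |x ^ 2|) := hz.abs
      rw [abs_of_nonneg (sq_nonneg x)] at h1
      exact (h1.eventually (gt_mem_nhds (show x ^ 2 < B by linarith))).mono fun k hk => hk.le
    filter_upwards [hb, hφ.eventually_gt_atTop 0] with k hk hk0 n
    have hk1 : (0 : ℝ) < φ k := by exact_mod_cast hk0
    obtain ⟨r0, r1⟩ := gamma_ratio_bound hν n
    have hc := Nat.choose_le_pow_div (α := ℝ) n (φ k)
    have h4 : (2 * (n : ℝ) + 1) ≤ 4 ^ n := by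
      have := one_add_mul_le_pow (a := (3 : ℝ)) (by norm_num) n
      norm_num at this
      have : (0:ℝ) ≤ n := n.cast_nonneg
      linarith
    rw [Real.norm_eq_abs, abs_mul, abs_mul, lagC, abs_mul, abs_mul, abs_pow, abs_pow, abs_neg,
      abs_of_nonneg r0, abs_of_pos (show (0 : ℝ) < 2 * n + 1 by positivity),
      abs_of_pos (show (0 : ℝ) < 1 / (4 * φ k) by positivity),
      abs_of_nonneg (show (0 : ℝ) ≤ ((φ k).choose n : ℝ) by positivity)]
    have e : K * (B ^ n / n.factorial) =
        4 ^ n * ((φ k : ℝ) ^ n / n.factorial * (1 / (4 * φ k)) ^ n * K) * B ^ n := by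
      rw [one_div, inv_pow, mul_pow]; field_simp
    rw [e]
    gcongr

/-- Two-sided bounds for the Dini function. -/
lemma dini_bounds {ν : ℝ} (hν1 : -1 < ν) {α1 : ℝ}
    (hα1pos : 0 < α1) (hα1zero : Dcal ν α1 = 0)
    (hα1min : ∀ x : ℝ, 0 < x → Dcal ν x = 0 → α1 ≤ x) :
    ∃ t : ℝ, t = 1 / α1 ^ 2 ∧
      (4 * ν + 13) / (16 * (ν + 1) ^ 2 * (ν + 2)) ≤ t * (3 / (4 * (ν + 1))) ∧
      ∀ x : ℝ, t * x ^ 2 < 1 →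
        Dcal ν x ≤
          (1 - t * x ^ 2) * (1 + t * x ^ 2) ^ (-(3 / (4 * (ν + 1)) / t - 1)) ∧
        (1 - t * x ^ 2) ^ (3 / (4 * (ν + 1)) / t) ≤ Dcal ν x := by
  have hν : 0 < ν + 1 := by linarith
  set S := 3 / (4 * (ν + 1)) with hS
  set S2 := (4 * ν + 13) / (16 * (ν + 1) ^ 2 * (ν + 2)) with hS2
  have hSpos : 0 < S := by positivity
  have hS2pos : 0 < S2 := by
    have : 0 < ν + 2 := by linarith
    have : 0 < 4 * ν + 13 := by linarith
    positivity
  choose u hu0 hur huS huS2 hub using fun k : ℕ => dinP_main hν1 (N := k + 1) (by omega)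
  have hmem : ∀ k, u k ∈ Set.Icc (S2 / S) S := fun k =>
    ⟨(div_le_iff₀ hSpos).2 (huS2 k), huS k⟩
  obtain ⟨t, ht, ψ, hψ, hlim⟩ := isCompact_Icc.tendsto_subseq hmem
  have htpos : 0 < t := lt_of_lt_of_le (by positivity) ht.1
  have hφ : Filter.Tendsto (fun k => ψ k + 1) Filter.atTop Filter.atTop :=
    (Filter.tendsto_add_atTop_nat 1).comp hψ.tendsto_atTop
  have hconst : ∀ x : ℝ, Filter.Tendsto (fun k => (dinP ν (ψ k + 1)).eval (x ^ 2)) Filter.atTop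
      (nhds (Dcal ν x)) := fun x => dinP_tendsto hν1 hφ (fun _ => x ^ 2) x tendsto_const_nhds
  have hbd : ∀ x : ℝ, t * x ^ 2 < 1 →
        Dcal ν x ≤ (1 - t * x ^ 2) * (1 + t * x ^ 2) ^ (-(S / t - 1)) ∧
        (1 - t * x ^ 2) ^ (S / t) ≤ Dcal ν x := by
    intro x hx
    have hlx : Filter.Tendsto (fun k => u (ψ k) * x ^ 2) Filter.atTop (nhds (t * x ^ 2)) :=
      hlim.mul_const _
    have hlS : Filter.Tendsto (fun k => S / u (ψ k)) Filter.atTop (nhds (S / t)) :=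
      tendsto_const_nhds.div hlim htpos.ne'
    have hev : ∀ᶠ k in Filter.atTop, u (ψ k) * x ^ 2 < 1 := hlx.eventually (gt_mem_nhds hx)
    have hp : 0 < 1 + t * x ^ 2 := by positivity
    constructor
    · refine le_of_tendsto_of_tendsto (hconst x) ((tendsto_const_nhds.sub hlx).mul
        ((tendsto_const_nhds.add hlx).rpow (hlS.sub_const 1).neg (Or.inl hp.ne'))) ?_
      filter_upwards [hev] with k hk
      exact (hub (ψ k) (x ^ 2) (sq_nonneg x) hk).1
    · refine le_of_tendsto_of_tendsto ((tendsto_const_nhds.sub hlx).rpow hlS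
        (Or.inl (by linarith))) (hconst x) ?_
      filter_upwards [hev] with k hk
      exact (hub (ψ k) (x ^ 2) (sq_nonneg x) hk).2
  refine ⟨t, ?_, ?_, hbd⟩
  · have hsq : (√(1 / t)) ^ 2 = 1 / t := Real.sq_sqrt (by positivity)
    have hz : Dcal ν (√(1 / t)) = 0 := by
      have h := dinP_tendsto hν1 hφ (fun k => 1 / u (ψ k)) (√(1 / t))
        (by rw [hsq]; exact tendsto_const_nhds.div hlim htpos.ne')
      have h2 : (fun k => (dinP ν (ψ k + 1)).eval (1 / u (ψ k))) = fun _ => 0 :=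
        funext fun k => hur (ψ k)
      rw [h2] at h
      exact tendsto_nhds_unique h tendsto_const_nhds
    have h1 := hα1min _ (Real.sqrt_pos.2 (by positivity)) hz
    have h2 : α1 ^ 2 ≤ 1 / t := by rw [← hsq]; gcongr
    have h3 : ¬ t * α1 ^ 2 < 1 := by
      intro h
      have := (hbd α1 h).2
      rw [hα1zero] at this
      have h5 : 0 < (1 - t * α1 ^ 2) ^ (S / t) := Real.rpow_pos_of_pos (by linarith) _
      linarith
    have h4 : t * α1 ^ 2 ≤ 1 := by
      rw [le_div_iff₀ htpos] at h2; linarith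
    have h5 : t * α1 ^ 2 = 1 := le_antisymm h4 (not_lt.1 h3)
    field_simp
    exact h5
  · exact (div_le_iff₀ hSpos).1 ht.1

lemma exists_small (m s : ℝ) (h : s < 2 * m) :
    ∃ u : ℝ, 0 < u ∧ u < 1 ∧ ((1 - u) / (1 + u)) ^ m < (1 - u) ^ s := by
  have hd : HasDerivAt (fun u : ℝ => m * Real.log (1 + u) + (s - m) * Real.log (1 - u))
      (m * (1 / (1 + 0)) + (s - m) * (-1 / (1 - 0))) 0 := by
    refine HasDerivAt.add (HasDerivAt.const_mul m ?_) (HasDerivAt.const_mul (s - m) ?_)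
    · exact ((hasDerivAt_id (0:ℝ)).const_add 1).log (by simp)
    · exact ((hasDerivAt_id (0:ℝ)).const_sub 1).log (by simp)
  have hd2 := hd.hasDerivWithinAt (s := Set.Ioi 0)
  rw [hasDerivWithinAt_iff_tendsto_slope' (by simp)] at hd2
  have hpos : 0 < m * (1 / (1 + 0)) + (s - m) * (-1 / (1 - 0)) := by norm_num; linarith
  have hev := hd2.eventually (lt_mem_nhds hpos)
  have hlt : ∀ᶠ u : ℝ in nhdsWithin 0 (Set.Ioi 0), u < 1 :=
    (gt_mem_nhds one_pos).filter_mono nhdsWithin_le_nhds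
  obtain ⟨u, ⟨hu, hu1⟩, hu0⟩ := ((hev.and hlt).and self_mem_nhdsWithin).exists
  have hu0 : 0 < u := hu0
  refine ⟨u, hu0, hu1, ?_⟩
  rw [slope_def_field] at hu
  simp at hu
  have hnum := (div_pos_iff_of_pos_right hu0).1 hu
  have h1 : 0 < 1 - u := by linarith
  have h2 : 0 < 1 + u := by linarith
  rw [← Real.log_lt_log_iff (by positivity) (by positivity), Real.log_rpow (by positivity),
    Real.log_rpow h1, Real.log_div h1.ne' h2.ne']
  nlinarith
end DiniAux

/-- Redheffer-type upper bound for the normalized Dini function, with the best possible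
exponent `m_ν = 3α_{ν,1}²/(8(ν+1))`. -/
theorem Dcal_redheffer_upper (ν : ℝ) (hν1 : -1 < ν) (hν8 : ν < 8) (α1 : ℝ)
    (hα1pos : 0 < α1) (hα1zero : Dcal ν α1 = 0)
    (hα1min : ∀ x : ℝ, 0 < x → Dcal ν x = 0 → α1 ≤ x) :
    (∀ x ∈ Set.Ioo (-α1) α1,
      Dcal ν x ≤ ((α1 ^ 2 - x ^ 2) / (α1 ^ 2 + x ^ 2)) ^ (3 * α1 ^ 2 / (8 * (ν + 1)))) ∧
    (∀ m : ℝ, 3 * α1 ^ 2 / (8 * (ν + 1)) < m →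
      ∃ x ∈ Set.Ioo (-α1) α1,
        ((α1 ^ 2 - x ^ 2) / (α1 ^ 2 + x ^ 2)) ^ m < Dcal ν x) := by
  have hν : 0 < ν + 1 := by linarith
  obtain ⟨t, ht, htS, hbd⟩ := dini_bounds hν1 hα1pos hα1zero hα1min
  have ha2 : 0 < α1 ^ 2 := by positivity
  have htpos : 0 < t := by rw [ht]; positivity
  have hmS : 3 / (4 * (ν + 1)) / t = 2 * (3 * α1 ^ 2 / (8 * (ν + 1))) := by
    rw [ht]; field_simp; ring
  have hm1 : 3 * α1 ^ 2 / (8 * (ν + 1)) ≤ 1 := by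
    have hν2 : 0 < ν + 2 := by linarith
    rw [ht, div_le_iff₀ (by positivity)] at htS
    rw [div_le_one (by positivity)]
    have e : 1 / α1 ^ 2 * (3 / (4 * (ν + 1))) * (16 * (ν + 1) ^ 2 * (ν + 2))
        = 12 * (ν + 1) * (ν + 2) / α1 ^ 2 := by field_simp; ring
    rw [e, le_div_iff₀ ha2] at htS
    have h1 : (4 * ν + 13) * (3 * α1 ^ 2) ≤ (4 * ν + 13) * (8 * (ν + 1)) := by
      nlinarith [mul_pos hν (show 0 < 8 - ν by linarith)]
    exact le_of_mul_le_mul_left h1 (by linarith)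
  have hquot : ∀ x : ℝ, (α1 ^ 2 - x ^ 2) / (α1 ^ 2 + x ^ 2) = (1 - t * x ^ 2) / (1 + t * x ^ 2) := by
    intro x
    rw [ht]
    have : 0 < α1 ^ 2 + x ^ 2 := by positivity
    field_simp
  set m0 := 3 * α1 ^ 2 / (8 * (ν + 1)) with hm0
  have htx : ∀ x ∈ Set.Ioo (-α1) α1, t * x ^ 2 < 1 := by
    intro x hx
    have : x ^ 2 < α1 ^ 2 := by nlinarith [hx.1, hx.2]
    rw [ht, one_div_mul_eq_div, div_lt_one ha2]
    exact this
  refine ⟨?_, ?_⟩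
  · intro x hx
    have h1 := htx x hx
    refine (hbd x h1).1.trans ?_
    rw [hquot, hmS]
    have hp : 0 < 1 + t * x ^ 2 := by positivity
    have hm : 0 < 1 - t * x ^ 2 := by linarith
    have e1 : (1 - t * x ^ 2) * (1 + t * x ^ 2) ^ (-(2 * m0 - 1))
        = ((1 - t * x ^ 2) * (1 + t * x ^ 2)) ^ (1 - m0)
          * ((1 - t * x ^ 2) / (1 + t * x ^ 2)) ^ m0 := by
      rw [Real.mul_rpow hm.le hp.le, Real.div_rpow hm.le hp.le, div_eq_mul_inv,
        ← Real.rpow_neg hp.le]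
      have a1 : (1 - t * x ^ 2) = (1 - t * x ^ 2) ^ (1 - m0) * (1 - t * x ^ 2) ^ m0 := by
        rw [← Real.rpow_add hm]; simp
      have a2 : (1 + t * x ^ 2) ^ (-(2 * m0 - 1))
          = (1 + t * x ^ 2) ^ (1 - m0) * (1 + t * x ^ 2) ^ (-m0) := by
        rw [← Real.rpow_add hp]; congr 1; ring
      rw [a2]
      nth_rewrite 1 [a1]
      ring
    rw [e1]
    refine mul_le_of_le_one_left (by positivity) ?_
    refine Real.rpow_le_one (by positivity) ?_ (by linarith)
    nlinarith [sq_nonneg (t * x ^ 2)]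
  · intro m hm
    obtain ⟨u, hu0, hu1, hu⟩ := exists_small m (2 * m0) (by linarith)
    have hsq : (√(u / t)) ^ 2 = u / t := Real.sq_sqrt (by positivity)
    have htu : t * (√(u / t)) ^ 2 = u := by rw [hsq]; field_simp
    have hlt : √(u / t) < α1 := by
      rw [Real.sqrt_lt' hα1pos, ht]
      rw [div_div_eq_mul_div, div_one]
      nlinarith
    have h0 : 0 ≤ √(u / t) := Real.sqrt_nonneg _
    refine ⟨√(u / t), ⟨by linarith, hlt⟩, ?_⟩
    rw [hquot, htu]
    have := (hbd (√(u / t)) (by rw [htu]; exact hu1)).2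
    rw [htu, hmS] at this
    exact hu.trans_le this
end

section
/- Let ν ∈ (-1, (1+√57)/2) and let γ_{ν,1} be the smallest positive zero of 𝒲_ν. Then 𝒲_ν(x) ≤ ((γ_{ν,1}⁴ - x⁴)/(γ_{ν,1}⁴ + x⁴))^{n_ν} for all x ∈ (-γ_{ν,1}, γ_{ν,1}), where n_ν = γ_{ν,1}⁴/(32(ν+1)(ν+2)(ν+3)). Moreover n_ν is the best possible exponent: for every n > n_ν there exists x ∈ (-γ_{ν,1}, γ_{ν,1}) with 𝒲_ν(x) > ((γ_{ν,1}⁴ - x⁴)/(γ_{ν,1}⁴ + x⁴))^n. -/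
open Real Set

lemma alt_bounds (b : ℕ → ℝ) (hb : ∀ n, 0 ≤ b n) (hd : ∀ n, b (n + 1) ≤ b n)
    (hs : Summable b) :
    0 ≤ ∑' n : ℕ, (-1 : ℝ) ^ n * b n ∧ ∑' n : ℕ, (-1 : ℝ) ^ n * b n ≤ b 0 := by
  have hs' : Summable (fun n : ℕ => (-1 : ℝ) ^ n * b n) := by
    apply Summable.of_norm
    refine hs.congr fun n => ?_
    rw [norm_mul, norm_pow, norm_neg, norm_one, one_pow, one_mul, Real.norm_of_nonneg (hb n)]
  have ht := hs'.hasSum.tendsto_sum_nat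
  have ha : Antitone b := antitone_nat_of_succ_le hd
  have h0 := ha.alternating_series_le_tendsto ht 0
  have h1 := ha.tendsto_le_alternating_series ht 0
  simp at h0 h1
  exact ⟨h0, h1⟩

lemma summ_of_half (A : ℕ → ℝ) (hA : ∀ n, 0 ≤ A n) (hh : ∀ n, 1 ≤ n → A (n + 1) ≤ A n / 2) :
    Summable A := by
  rw [← summable_nat_add_iff 1]
  have hb : ∀ n : ℕ, A (n + 1) ≤ A 1 * (1 / 2) ^ n := by
    intro n
    induction n with
    | zero => simp
    | succ k ih =>
      have := hh (k + 1) (by omega)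
      rw [pow_succ]
      linarith
  exact Summable.of_nonneg_of_le (fun n => hA _) hb
    ((summable_geometric_of_lt_one (by norm_num) (by norm_num)).mul_left _)

lemma summ_alt (b : ℕ → ℝ) (hb : ∀ n, 0 ≤ b n) (hs : Summable b) :
    Summable (fun n : ℕ => (-1 : ℝ) ^ n * b n) := by
  apply Summable.of_norm
  refine hs.congr fun n => ?_
  rw [norm_mul, norm_pow, norm_neg, norm_one, one_pow, one_mul, Real.norm_of_nonneg (hb n)]

/-- tail bounds of an alternating series with halving terms -/
lemma alt_tail (A : ℕ → ℝ) (hA : ∀ n, 0 ≤ A n) (hh : ∀ n, 1 ≤ n → A (n + 1) ≤ A n / 2) :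
    A 0 - A 1 ≤ ∑' n : ℕ, (-1 : ℝ) ^ n * A n ∧
    ∑' n : ℕ, (-1 : ℝ) ^ n * A n ≤ A 0 - A 1 + A 2 ∧
    A 0 - A 1 + A 2 - A 3 ≤ ∑' n : ℕ, (-1 : ℝ) ^ n * A n := by
  have hs := summ_of_half A hA hh
  have hs' := summ_alt A hA hs
  have hd : ∀ k n : ℕ, 1 ≤ k → A (n + 1 + k) ≤ A (n + k) := by
    intro k n hk
    have := hh (n + k) (by omega)
    have h2 := hA (n + k)
    rw [show n + 1 + k = n + k + 1 by ring]
    linarith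
  have e2 := hs'.sum_add_tsum_nat_add 2
  have e3 := hs'.sum_add_tsum_nat_add 3
  have b2 := alt_bounds (fun n => A (n + 2)) (fun n => hA _) (fun n => hd 2 n (by norm_num))
    ((summable_nat_add_iff 2).2 hs)
  have b3 := alt_bounds (fun n => A (n + 3)) (fun n => hA _) (fun n => hd 3 n (by norm_num))
    ((summable_nat_add_iff 3).2 hs)
  simp only [Finset.sum_range_succ, Finset.sum_range_zero, pow_add, mul_assoc] at e2 e3
  norm_num at e2 e3 b2 b3
  rw [tsum_neg] at e3
  refine ⟨?_, ?_, ?_⟩ <;> linarith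

lemma exp_lower (y : ℝ) (hy : 0 ≤ y) : 1 - y + y ^ 2 / 2 - y ^ 3 / 6 ≤ Real.exp (-y) := by
  have hd : ∀ x : ℝ, HasDerivAt (fun y : ℝ => (1 - y + y ^ 2 / 2 - y ^ 3 / 6) * Real.exp y)
      (-(x ^ 3 / 6) * Real.exp x) x := by
    intro x
    have h1 : HasDerivAt (fun y : ℝ => 1 - y + y ^ 2 / 2 - y ^ 3 / 6)
        (0 - 1 + (2 * x) / 2 - (3 * x ^ 2) / 6) x := by
      have := ((((hasDerivAt_const x (1 : ℝ)).sub (hasDerivAt_id x)).add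
        ((hasDerivAt_pow 2 x).div_const 2)).sub ((hasDerivAt_pow 3 x).div_const 6))
      refine HasDerivAt.congr_deriv (f := fun y : ℝ => 1 - y + y ^ 2 / 2 - y ^ 3 / 6) this ?_
      norm_num
    refine HasDerivAt.congr_deriv (f := fun y : ℝ => (1 - y + y ^ 2 / 2 - y ^ 3 / 6) * Real.exp y)
      (h1.mul (Real.hasDerivAt_exp x)) ?_
    ring
  have hanti : AntitoneOn (fun y : ℝ => (1 - y + y ^ 2 / 2 - y ^ 3 / 6) * Real.exp y) (Set.Ici 0) := by
    apply antitoneOn_of_hasDerivWithinAt_nonpos (convex_Ici 0)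
      (fun x _ => (hd x).continuousAt.continuousWithinAt)
      (fun x _ => (hd x).hasDerivWithinAt)
    intro x hx
    rw [interior_Ici] at hx
    have : 0 < x := hx
    have : 0 ≤ x ^ 3 / 6 * Real.exp x := by positivity
    linarith
  have := hanti (Set.mem_Ici.2 le_rfl) (Set.mem_Ici.2 hy) hy
  simp at this
  rw [Real.exp_neg]
  rwa [← one_div, le_div_iff₀ (Real.exp_pos y)]

/-- the abstract upper bound -/
lemma alt_upper (A : ℕ → ℝ) (hA : ∀ n, 0 ≤ A n) (hh : ∀ n, 1 ≤ n → A (n + 1) ≤ A n / 2)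
    (h0 : A 0 = 1) (κ l : ℝ) (hκ0 : 0 ≤ κ) (hκ : κ ≤ 1 / 4) (hl0 : 0 ≤ l) (hl : l ≤ 2 / 5)
    (h2 : A 2 = κ * A 1 ^ 2) (h3 : A 3 = l * κ ^ 2 * A 1 ^ 3) (hs2 : A 1 ≤ 2)
    (hz : ∑' n : ℕ, (-1 : ℝ) ^ n * A n = 0) (u : ℝ) (hu0 : 0 ≤ u) (hu1 : u ≤ 1) :
    1 ≤ A 1 ∧ ∑' n : ℕ, (-1 : ℝ) ^ n * (A n * u ^ n) ≤ (1 - u) * Real.exp (-((A 1 - 1) * u)) := by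
  obtain ⟨t1, t2, t3⟩ := alt_tail A hA hh
  rw [hz, h0] at t1 t2 t3
  have hs1 : 1 ≤ A 1 := by linarith
  refine ⟨hs1, ?_⟩
  have hs := summ_of_half A hA hh
  have hs' := summ_alt A hA hs
  have hU : Summable (fun n => A n * u ^ n) :=
    Summable.of_nonneg_of_le (fun n => mul_nonneg (hA n) (pow_nonneg hu0 n))
      (fun n => mul_le_of_le_one_right (hA n) (pow_le_one₀ hu0 hu1)) hs
  have hU' := summ_alt _ (fun n => mul_nonneg (hA n) (pow_nonneg hu0 n)) hU
  set s := A 1 with hsdef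
  set m := s - 1 with hm
  set d := A 2 - m with hd
  -- step 1
  have key : ∑' n : ℕ, (-1 : ℝ) ^ n * (A n * u ^ n) ≤ (1 - u) * (1 - m * u + d * u ^ 2) := by
    have e1 := hs'.sum_add_tsum_nat_add 4
    have e2 := hU'.sum_add_tsum_nat_add 4
    simp only [Finset.sum_range_succ, Finset.sum_range_zero] at e1 e2
    have eB : ∑' n : ℕ, (-1 : ℝ) ^ n * (A (n + 4) * (1 - u ^ (n + 1))) =
        ∑' n : ℕ, (-1 : ℝ) ^ (n + 4) * A (n + 4) -
        ∑' n : ℕ, (-1 : ℝ) ^ n * (A (n + 4) * u ^ (n + 1)) := by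
      rw [← Summable.tsum_sub ((summable_nat_add_iff 4).2 hs')]
      · congr 1; ext n; rw [pow_add (-1 : ℝ) n 4]; norm_num; ring
      · apply summ_alt _ (fun n => mul_nonneg (hA _) (pow_nonneg hu0 _))
        exact Summable.of_nonneg_of_le (fun n => mul_nonneg (hA _) (pow_nonneg hu0 _))
          (fun n => mul_le_of_le_one_right (hA _) (pow_le_one₀ hu0 hu1))
          ((summable_nat_add_iff 4).2 hs)
    have eC : ∑' n : ℕ, (-1 : ℝ) ^ (n + 4) * (A (n + 4) * u ^ (n + 4)) =
        u ^ 3 * ∑' n : ℕ, (-1 : ℝ) ^ n * (A (n + 4) * u ^ (n + 1)) := by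
      rw [← tsum_mul_left]
      congr 1; ext n; rw [pow_add (-1 : ℝ) n 4]; norm_num; ring
    have hB0 : ∀ n : ℕ, 0 ≤ 1 - u ^ (n + 1) := fun n => by
      have := pow_le_one₀ (n := n + 1) hu0 hu1
      linarith
    have hB := (alt_bounds (fun n => A (n + 4) * (1 - u ^ (n + 1)))
      (fun n => mul_nonneg (hA _) (hB0 n)) (fun n => by
        have a1 := hh (n + 4) (by omega)
        have a2 : 1 - u ^ (n + 2) ≤ 2 * (1 - u ^ (n + 1)) := by
          have p0 : 0 ≤ u ^ n := pow_nonneg hu0 n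
          have p1 : u ^ n ≤ 1 := pow_le_one₀ hu0 hu1
          have : 2 * (1 - u ^ (n + 1)) - (1 - u ^ (n + 2)) = (1 - u ^ n) + u ^ n * (1 - u) ^ 2 := by
            ring
          have : 0 ≤ u ^ n * (1 - u) ^ 2 := by positivity
          linarith
        show A (n + 1 + 4) * (1 - u ^ (n + 1 + 1)) ≤ A (n + 4) * (1 - u ^ (n + 1))
        rw [show n + 1 + 4 = n + 4 + 1 by ring]
        calc A (n + 4 + 1) * (1 - u ^ (n + 1 + 1)) ≤ (A (n + 4) / 2) * (2 * (1 - u ^ (n + 1))) :=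
              mul_le_mul a1 a2 (hB0 _) (by have := hA (n + 4); linarith)
          _ = _ := by ring)
      (Summable.of_nonneg_of_le (fun n => mul_nonneg (hA _) (hB0 n))
        (fun n => mul_le_of_le_one_right (hA _) (by have := pow_nonneg hu0 (n + 1); linarith))
        ((summable_nat_add_iff 4).2 hs))).1
    rw [eB] at hB
    rw [eC] at e2
    set X := ∑' n : ℕ, (-1 : ℝ) ^ (n + 4) * A (n + 4)
    set Y := ∑' n : ℕ, (-1 : ℝ) ^ n * (A (n + 4) * u ^ (n + 1))
    rw [hz] at e1
    norm_num at e1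
    rw [← e2]
    norm_num
    rw [h0] at *
    have h3u : 0 ≤ u ^ 3 := by positivity
    have hY := mul_le_mul_of_nonneg_left (show Y ≤ X by linarith) h3u
    have hX : X = d * 1 - 0 * s + (A 3 - d) - (1 - s + A 2 - d) - d := by simp only [hd, hm]; linarith
    have hX' : X = A 3 - d := by rw [hX, hd, hm]; ring
    rw [hX'] at hY
    have hA2 : A 2 = d + m := by rw [hd]; ring
    have hs3 : A 1 = m + 1 := by rw [hm]; ring
    rw [hA2, hs3]
    nlinarith [hY]
  refine key.trans ?_
  apply mul_le_mul_of_nonneg_left _ (by linarith)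
  have hm0 : 0 ≤ m := by linarith
  have hexp := exp_lower (m * u) (mul_nonneg hm0 hu0)
  refine le_trans ?_ hexp
  have hdA : d ≤ A 3 := by rw [hd, hm]; linarith
  have hmlow : κ * s ^ 2 * (1 - s / 10) ≤ m := by
    have : A 2 - A 3 ≤ m := by rw [hm]; linarith
    rw [h2, h3] at this
    refine le_trans ?_ this
    have hlk : l * κ ≤ 2 / 5 * (1 / 4) := mul_le_mul hl hκ hκ0 (by norm_num)
    have : 0 ≤ κ * s ^ 3 := by positivity
    nlinarith
  have hsq : (κ * s ^ 2 * (1 - s / 10)) ^ 2 ≤ m ^ 2 :=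
    pow_le_pow_left₀ (mul_nonneg (by positivity) (by linarith)) hmlow 2
  have hpoly : 2 / 5 ≤ s * (1 - s / 10) ^ 2 * ((4 - s) / 6) := by
    nlinarith [mul_nonneg (sub_nonneg.2 hs1) (sub_nonneg.2 hs2), mul_nonneg (mul_nonneg (sub_nonneg.2 hs1) (sub_nonneg.2 hs2)) (sub_nonneg.2 hs1), mul_nonneg (mul_nonneg (sub_nonneg.2 hs1) (sub_nonneg.2 hs2)) (sub_nonneg.2 hs2), sq_nonneg ((s - 1) * (2 - s))]
  have hd2 : d ≤ m ^ 2 * ((4 - s) / 6) := by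
    refine hdA.trans ?_
    rw [h3]
    have hk : 0 ≤ κ ^ 2 * s ^ 3 := by positivity
    calc l * κ ^ 2 * s ^ 3 = l * (κ ^ 2 * s ^ 3) := by ring
      _ ≤ (2 / 5) * (κ ^ 2 * s ^ 3) := mul_le_mul_of_nonneg_right hl hk
      _ ≤ (s * (1 - s / 10) ^ 2 * ((4 - s) / 6)) * (κ ^ 2 * s ^ 3) :=
        mul_le_mul_of_nonneg_right hpoly hk
      _ = (κ * s ^ 2 * (1 - s / 10)) ^ 2 * ((4 - s) / 6) := by ring
      _ ≤ _ := mul_le_mul_of_nonneg_right hsq (by linarith)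
  have hd3 : d ≤ m ^ 2 / 2 - m ^ 3 / 6 := by
    refine hd2.trans (le_of_eq ?_)
    rw [show s = m + 1 by rw [hm]; ring]; ring
  have hu3 : m ^ 3 * u ^ 3 ≤ m ^ 3 * u ^ 2 :=
    mul_le_mul_of_nonneg_left (pow_le_pow_of_le_one hu0 hu1 (by norm_num)) (by positivity)
  have := mul_le_mul_of_nonneg_right hd3 (sq_nonneg u)
  nlinarith

lemma stepC (s u : ℝ) (hs1 : 1 ≤ s) (hs2 : s ≤ 2) (hu0 : 0 ≤ u) (hu1 : u < 1) :
    (1 - u) * Real.exp (-((s - 1) * u)) ≤ ((1 - u) / (1 + u)) ^ (s / 2) := by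
  have p1 : 0 < 1 - u := by linarith
  have p2 : 0 < 1 + u := by linarith
  rw [Real.rpow_def_of_pos (div_pos p1 p2), Real.log_div p1.ne' p2.ne']
  nth_rw 1 [← Real.exp_log p1]
  rw [← Real.exp_add, Real.exp_le_exp]
  have l1 := Real.log_le_sub_one_of_pos p1
  have l2 := Real.log_le_sub_one_of_pos p2
  have a1 : 0 ≤ (2 - s) * -(Real.log (1 - u) + Real.log (1 + u)) :=
    mul_nonneg (by linarith) (by linarith)
  have a2 : 0 ≤ (s - 1) * (u - Real.log (1 + u)) := mul_nonneg (by linarith) (by linarith)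
  nlinarith

lemma stepD (s n u : ℝ) (hs1 : 1 ≤ s) (hn : s / 2 < n) (hu : u = (2 * n - s) / (2 * s * (1 + 2 * n))) :
    0 < u ∧ u < 1 ∧ ((1 - u) / (1 + u)) ^ n < 1 - s * u := by
  have hn0 : 0 < n := by linarith
  have hden : 0 < 2 * s * (1 + 2 * n) := by positivity
  have hu0 : 0 < u := by rw [hu]; exact div_pos (by linarith) hden
  have hu1 : u < 1 := by rw [hu, div_lt_one hden]; nlinarith
  refine ⟨hu0, hu1, ?_⟩
  have p1 : 0 < 1 - u := by linarith
  have p2 : 0 < 1 + u := by linarith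
  rw [Real.rpow_def_of_pos (div_pos p1 p2)]
  have l1 := Real.log_le_sub_one_of_pos (div_pos p1 p2)
  have e : (1 - u) / (1 + u) - 1 = -(2 * u / (1 + u)) := by field_simp; ring
  rw [e] at l1
  have q : 0 < 1 + 2 * u * n / (1 + u) := by positivity
  have l2 : Real.exp (Real.log ((1 - u) / (1 + u)) * n) ≤ 1 / (1 + 2 * u * n / (1 + u)) := by
    calc _ ≤ Real.exp (-(2 * u * n / (1 + u))) := by
            rw [Real.exp_le_exp]
            calc _ ≤ -(2 * u / (1 + u)) * n := mul_le_mul_of_nonneg_right l1 hn0.le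
              _ = _ := by ring
      _ ≤ _ := by
        rw [Real.exp_neg, ← one_div]
        apply one_div_le_one_div_of_le q
        have := Real.add_one_le_exp (2 * u * n / (1 + u))
        linarith
  refine l2.trans_lt ?_
  have e2 : 1 / (1 + 2 * u * n / (1 + u)) = (1 + u) / (1 + u + 2 * u * n) := by field_simp
  rw [e2, div_lt_iff₀ (by positivity)]
  have hs0 : 0 < s := by linarith
  have hue : 2 * (s * u * (1 + 2 * n)) = 2 * n - s := by rw [hu]; field_simp
  have : 0 < u * (2 * n - s - s * u * (1 + 2 * n)) := mul_pos hu0 (by linarith)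
  nlinarith

/-- absolute values of the terms, as a function of `T = x ^ 4` -/
noncomputable def Ac (ν T : ℝ) (n : ℕ) : ℝ :=
  Real.Gamma (ν + 1) * Real.Gamma (ν + 2) * T ^ n /
    ((2 : ℝ) ^ (4 * n) * (n.factorial : ℝ) * Real.Gamma (ν + n + 1) * Real.Gamma (ν + 2 * n + 2))

lemma Wcal_eq (ν x : ℝ) : Wcal ν x = ∑' n : ℕ, (-1 : ℝ) ^ n * Ac ν (x ^ 4) n := by
  unfold Wcal Ac
  congr 1; ext n
  rw [pow_mul x, mul_assoc, ← mul_div_assoc]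

lemma Ac_nonneg (ν T : ℝ) (hν : -1 < ν) (hT : 0 ≤ T) (n : ℕ) : 0 ≤ Ac ν T n := by
  unfold Ac
  have hn : (0 : ℝ) ≤ n := Nat.cast_nonneg n
  have g1 := Real.Gamma_pos_of_pos (show 0 < ν + 1 by linarith)
  have g2 := Real.Gamma_pos_of_pos (show 0 < ν + 2 by linarith)
  have g3 := Real.Gamma_pos_of_pos (show 0 < ν + n + 1 by linarith)
  have g4 := Real.Gamma_pos_of_pos (show 0 < ν + 2 * n + 2 by linarith)
  positivity

lemma Ac_zero (ν T : ℝ) (hν : -1 < ν) : Ac ν T 0 = 1 := by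
  unfold Ac
  have g1 := Real.Gamma_pos_of_pos (show 0 < ν + 1 by linarith)
  have g2 := Real.Gamma_pos_of_pos (show 0 < ν + 2 by linarith)
  simp
  exact ⟨g1.ne', g2.ne'⟩

lemma Ac_mul (ν T u : ℝ) (n : ℕ) : Ac ν (T * u) n = Ac ν T n * u ^ n := by
  unfold Ac
  rw [mul_pow]; ring

lemma Ac_succ (ν T : ℝ) (hν : -1 < ν) (n : ℕ) :
    Ac ν T (n + 1) = Ac ν T n *
      (T / (16 * ((n + 1) * (ν + n + 1) * (ν + 2 * n + 2) * (ν + 2 * n + 3)))) := by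
  unfold Ac
  have hn : (0 : ℝ) ≤ n := Nat.cast_nonneg n
  have h1 : 0 < ν + n + 1 := by linarith
  have h2 : 0 < ν + 2 * n + 2 := by linarith
  have h3 : 0 < ν + 2 * n + 3 := by linarith
  have g3 := Real.Gamma_pos_of_pos h1
  have g4 := Real.Gamma_pos_of_pos h2
  have e1 : Real.Gamma (ν + (n + 1 : ℕ) + 1) = (ν + n + 1) * Real.Gamma (ν + n + 1) := by
    rw [← Real.Gamma_add_one h1.ne']; push_cast; congr 1; ring
  have e2 : Real.Gamma (ν + 2 * (n + 1 : ℕ) + 2) =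
      (ν + 2 * n + 3) * ((ν + 2 * n + 2) * Real.Gamma (ν + 2 * n + 2)) := by
    rw [← Real.Gamma_add_one h2.ne', show ν + 2 * (n : ℝ) + 2 + 1 = ν + 2 * n + 3 by ring,
      ← Real.Gamma_add_one h3.ne']; push_cast; congr 1; ring
  rw [e1, e2, Nat.factorial_succ, show 4 * (n + 1) = 4 * n + 4 by ring, pow_add (2 : ℝ), pow_succ T]
  push_cast
  have hf : (0 : ℝ) < n.factorial := by exact_mod_cast n.factorial_pos
  field_simp
  norm_num
  ring

lemma nu_facts (ν : ℝ) (hν1 : -1 < ν) (hνr : ν < (1 + Real.sqrt 57) / 2) :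
    ν ^ 2 - ν - 14 < 0 ∧ ν < 5 := by
  have h1 := Real.sq_sqrt (show (0 : ℝ) ≤ 57 by norm_num)
  have h0 := Real.sqrt_nonneg 57
  have h8 : Real.sqrt 57 < 8 := by nlinarith
  have h7 : 7 < Real.sqrt 57 := by nlinarith
  refine ⟨?_, by linarith⟩
  nlinarith [mul_pos (show 0 < (1 + Real.sqrt 57) / 2 - ν by linarith)
    (show 0 < ν + (Real.sqrt 57 - 1) / 2 by linarith)]

lemma Ac_half (ν T : ℝ) (hν : -1 < ν) (hq : ν ^ 2 - ν - 14 < 0) (hT : 0 ≤ T)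
    (hT2 : T ≤ 32 * ((ν + 1) * (ν + 2) * (ν + 3))) (n : ℕ) (hn : 1 ≤ n) :
    Ac ν T (n + 1) ≤ Ac ν T n / 2 := by
  rw [Ac_succ ν T hν n]
  have hn1 : (1 : ℝ) ≤ n := by exact_mod_cast hn
  have hA := Ac_nonneg ν T hν hT n
  rw [div_eq_mul_one_div (Ac ν T n) 2]
  apply mul_le_mul_of_nonneg_left _ hA
  have p : 0 < ν + 1 := by linarith
  have p2 : 0 < ν + 2 := by linarith
  have p4 : 0 < ν + 4 := by linarith
  have p5 : 0 < ν + 5 := by linarith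
  have hge : 2 * (ν + 2) * (ν + 4) * (ν + 5) ≤
      ((n : ℝ) + 1) * (ν + n + 1) * (ν + 2 * n + 2) * (ν + 2 * n + 3) := by
    have q1 : 0 ≤ ν + n + 1 := by linarith
    have q2 : 0 ≤ ν + 2 * n + 2 := by linarith
    apply mul_le_mul _ (by linarith) p5.le (by positivity)
    apply mul_le_mul _ (by linarith) p4.le (by positivity)
    apply mul_le_mul (by linarith) (by linarith) p2.le (by positivity)
  have hbase : 0 < 2 * (ν + 2) * (ν + 4) * (ν + 5) := by positivity
  rw [div_le_iff₀ (by linarith)]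
  have : 4 * ((ν + 1) * (ν + 2) * (ν + 3)) ≤ 2 * (ν + 2) * (ν + 4) * (ν + 5) := by
    nlinarith [mul_pos p2 (show 0 < -(ν ^ 2 - ν - 14) by linarith)]
  linarith

lemma Ac_one (ν T : ℝ) (hν : -1 < ν) : Ac ν T 1 = T / (16 * ((ν + 1) * (ν + 2) * (ν + 3))) := by
  have := Ac_succ ν T hν 0
  rw [Ac_zero ν T hν] at this
  simp at this
  exact this

lemma Ac_two (ν T : ℝ) (hν : -1 < ν) :
    Ac ν T 2 = (ν + 1) * (ν + 3) / (2 * (ν + 4) * (ν + 5)) * Ac ν T 1 ^ 2 := by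
  have := Ac_succ ν T hν 1
  rw [Ac_one ν T hν] at this ⊢
  norm_num at this
  rw [this]
  have p1 : ν + 1 ≠ 0 := by linarith
  have p2 : ν + 2 ≠ 0 := by linarith
  have p3 : ν + 3 ≠ 0 := by linarith
  have p4 : ν + 4 ≠ 0 := by linarith
  have p5 : ν + 5 ≠ 0 := by linarith
  rw [show ν + 1 + 1 = ν + 2 by ring, show ν + 2 + 2 = ν + 4 by ring, show ν + 2 + 3 = ν + 5 by ring]
  field_simp
  try ring

lemma Ac_three (ν T : ℝ) (hν : -1 < ν) :
    Ac ν T 3 = (2 * (ν + 2) * (ν + 4) * (ν + 5) / (3 * (ν + 3) * (ν + 6) * (ν + 7))) *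
      ((ν + 1) * (ν + 3) / (2 * (ν + 4) * (ν + 5))) ^ 2 * Ac ν T 1 ^ 3 := by
  have := Ac_succ ν T hν 2
  rw [Ac_two ν T hν, Ac_one ν T hν] at this
  rw [Ac_one ν T hν]
  norm_num at this
  rw [this]
  have p1 : ν + 1 ≠ 0 := by linarith
  have p2 : ν + 2 ≠ 0 := by linarith
  have p3 : ν + 3 ≠ 0 := by linarith
  have p4 : ν + 4 ≠ 0 := by linarith
  have p5 : ν + 5 ≠ 0 := by linarith
  have p6 : ν + 6 ≠ 0 := by linarith
  have p7 : ν + 7 ≠ 0 := by linarith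
  rw [show ν + 2 + 1 = ν + 3 by ring, show ν + 4 + 2 = ν + 6 by ring, show ν + 4 + 3 = ν + 7 by ring]
  field_simp
  try ring

lemma kappa_lt (ν : ℝ) (hν : -1 < ν) (hq : ν ^ 2 - ν - 14 < 0) :
    (ν + 1) * (ν + 3) / (2 * (ν + 4) * (ν + 5)) < 1 / 4 := by
  have p4 : 0 < ν + 4 := by linarith
  have p5 : 0 < ν + 5 := by linarith
  rw [div_lt_iff₀ (by positivity)]
  nlinarith

lemma lam_le (ν : ℝ) (hν : -1 < ν) (h5 : ν < 5) :
    2 * (ν + 2) * (ν + 4) * (ν + 5) / (3 * (ν + 3) * (ν + 6) * (ν + 7)) ≤ 2 / 5 := by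
  have p3 : 0 < ν + 3 := by linarith
  have p6 : 0 < ν + 6 := by linarith
  have p7 : 0 < ν + 7 := by linarith
  rw [div_le_iff₀ (by positivity)]
  have a : 0 < ν + 1 := by linarith
  have b : 0 < 5 - ν := by linarith
  nlinarith [mul_pos a b, mul_pos (mul_pos a a) b]

lemma T_bound (ν : ℝ) (hν : -1 < ν) (hq : ν ^ 2 - ν - 14 < 0) (γ1 : ℝ) (hpos : 0 < γ1)
    (hmin : ∀ x : ℝ, 0 < x → Wcal ν x = 0 → γ1 ≤ x) :
    γ1 ^ 4 ≤ 32 * ((ν + 1) * (ν + 2) * (ν + 3)) := by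
  set M := 32 * ((ν + 1) * (ν + 2) * (ν + 3)) with hM
  have hP : 0 < (ν + 1) * (ν + 2) * (ν + 3) := by
    have p1 : 0 < ν + 1 := by linarith
    have p2 : 0 < ν + 2 := by linarith
    have p3 : 0 < ν + 3 := by linarith
    positivity
  have hM0 : 0 < M := by positivity
  by_contra hcon
  push Not at hcon
  set X := M ^ (1 / 4 : ℝ) with hX
  have hX0 : 0 < X := Real.rpow_pos_of_pos hM0 _
  have hX4 : X ^ 4 = M := by
    rw [hX, ← Real.rpow_natCast, ← Real.rpow_mul hM0.le]; norm_num
  have hXg : X < γ1 := lt_of_pow_lt_pow_left₀ 4 hpos.le (by rw [hX4]; exact hcon)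
  have hA := Ac_nonneg ν M hν hM0.le
  have hh := Ac_half ν M hν hq hM0.le hM.le
  have hneg : Wcal ν X < 0 := by
    rw [Wcal_eq, hX4]
    have := (alt_tail _ hA hh).2.1
    have h1 : Ac ν M 1 = 2 := by rw [Ac_one ν M hν, div_eq_iff (by positivity), hM]; ring
    rw [Ac_two ν M hν, h1, Ac_zero ν M hν] at this
    have := kappa_lt ν hν hq
    linarith
  have hcont : ContinuousOn (Wcal ν) (Set.Icc 0 X) := by
    have he : Wcal ν = fun x => ∑' n : ℕ, (-1 : ℝ) ^ n * Ac ν (x ^ 4) n := by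
      ext x; exact Wcal_eq ν x
    rw [he]
    refine continuousOn_tsum (u := Ac ν M) ?_ (summ_of_half _ hA hh) ?_
    · intro n
      unfold Ac
      fun_prop
    · intro n x hx
      have hx4 : x ^ 4 ≤ M := by rw [← hX4]; exact pow_le_pow_left₀ hx.1 hx.2 4
      rw [norm_mul, norm_pow, norm_neg, norm_one, one_pow, one_mul,
        Real.norm_of_nonneg (Ac_nonneg ν _ hν (by positivity) n)]
      have e : x ^ 4 = M * (x ^ 4 / M) := by field_simp
      rw [e, Ac_mul]
      exact mul_le_of_le_one_right (hA n) (pow_le_one₀ (by positivity) ((div_le_one hM0).2 hx4))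
  have h0 : Wcal ν 0 = 1 := by
    rw [Wcal_eq, tsum_eq_single 0]
    · rw [Ac_zero _ _ hν]; norm_num
    · intro n hn
      unfold Ac
      simp [hn]
  obtain ⟨y, hy, hy0⟩ := intermediate_value_Icc' hX0.le hcont
    (show (0 : ℝ) ∈ Set.Icc (Wcal ν X) (Wcal ν 0) from ⟨hneg.le, by rw [h0]; norm_num⟩)
  have hyne : y ≠ 0 := by
    rintro rfl
    rw [h0] at hy0
    norm_num at hy0
  have := hmin y (lt_of_le_of_ne hy.1 (Ne.symm hyne)) hy0
  linarith [hy.2]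

/-- Redheffer-type upper bound for the normalized cross-product `𝒲_ν`, with the best
possible exponent `n_ν = γ_{ν,1}⁴/(32(ν+1)(ν+2)(ν+3))`. -/
theorem Wcal_redheffer_upper (ν : ℝ) (hν1 : -1 < ν)
    (hνr : ν < (1 + Real.sqrt 57) / 2) (γ1 : ℝ)
    (hγ1pos : 0 < γ1) (hγ1zero : Wcal ν γ1 = 0)
    (hγ1min : ∀ x : ℝ, 0 < x → Wcal ν x = 0 → γ1 ≤ x) :
    (∀ x ∈ Set.Ioo (-γ1) γ1,
      Wcal ν x ≤ ((γ1 ^ 4 - x ^ 4) / (γ1 ^ 4 + x ^ 4)) ^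
        (γ1 ^ 4 / (32 * ((ν + 1) * (ν + 2) * (ν + 3))))) ∧
    (∀ n : ℝ, γ1 ^ 4 / (32 * ((ν + 1) * (ν + 2) * (ν + 3))) < n →
      ∃ x ∈ Set.Ioo (-γ1) γ1,
        ((γ1 ^ 4 - x ^ 4) / (γ1 ^ 4 + x ^ 4)) ^ n < Wcal ν x) := by
  obtain ⟨hq, h5⟩ := nu_facts ν hν1 hνr
  have hTM := T_bound ν hν1 hq γ1 hγ1pos hγ1min
  have p1 : 0 < ν + 1 := by linarith
  have p2 : 0 < ν + 2 := by linarith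
  have p3 : 0 < ν + 3 := by linarith
  have p4 : 0 < ν + 4 := by linarith
  have p5 : 0 < ν + 5 := by linarith
  have p6 : 0 < ν + 6 := by linarith
  have p7 : 0 < ν + 7 := by linarith
  set T := γ1 ^ 4 with hT
  have hT0 : 0 < T := by positivity
  have hA := Ac_nonneg ν T hν1 hT0.le
  have hh := Ac_half ν T hν1 hq hT0.le hTM
  set s := Ac ν T 1 with hs
  have hsT : T / (32 * ((ν + 1) * (ν + 2) * (ν + 3))) = s / 2 := by
    rw [hs, Ac_one ν T hν1]; field_simp; norm_num
  have hs2 : s ≤ 2 := by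
    have : T / (32 * ((ν + 1) * (ν + 2) * (ν + 3))) ≤ 1 := (div_le_one (by positivity)).2 hTM
    linarith
  have hz : ∑' n : ℕ, (-1 : ℝ) ^ n * Ac ν T n = 0 := by rw [← hγ1zero, Wcal_eq]
  have main := alt_upper (Ac ν T) hA hh (Ac_zero ν T hν1) _ _ (by positivity)
    (kappa_lt ν hν1 hq).le (by positivity) (lam_le ν hν1 h5) (Ac_two ν T hν1) (Ac_three ν T hν1)
    hs2 hz
  have hs1 : 1 ≤ s := (main 0 le_rfl zero_le_one).1
  have hW : ∀ x : ℝ, Wcal ν x = ∑' n : ℕ, (-1 : ℝ) ^ n * (Ac ν T n * (x ^ 4 / T) ^ n) := by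
    intro x
    rw [Wcal_eq]
    congr 1; ext n
    rw [← Ac_mul]
    congr 2
    field_simp
  have hR : ∀ x : ℝ, (T - x ^ 4) / (T + x ^ 4) = (1 - x ^ 4 / T) / (1 + x ^ 4 / T) := by
    intro x
    field_simp
  rw [hsT]
  constructor
  · intro x hx
    have hx4 : x ^ 4 < T := by
      have : |x| < γ1 := abs_lt.2 hx
      have := pow_lt_pow_left₀ this (abs_nonneg x) (show 4 ≠ 0 by norm_num)
      rwa [Even.pow_abs (by decide)] at this
    have hu0 : 0 ≤ x ^ 4 / T := by positivity
    have hu1 : x ^ 4 / T < 1 := (div_lt_one hT0).2 hx4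
    rw [hW, hR]
    exact (main _ hu0 hu1.le).2.trans (stepC s _ hs1 hs2 hu0 hu1)
  · intro n hn
    obtain ⟨hu0, hu1, hlt⟩ := stepD s n _ hs1 hn rfl
    set u := (2 * n - s) / (2 * s * (1 + 2 * n)) with hu
    have hr4 : (u ^ (1 / 4 : ℝ)) ^ 4 = u := by
      rw [← Real.rpow_natCast, ← Real.rpow_mul hu0.le]; norm_num
    have hr0 : 0 < u ^ (1 / 4 : ℝ) := Real.rpow_pos_of_pos hu0 _
    have hr1 : u ^ (1 / 4 : ℝ) < 1 := Real.rpow_lt_one hu0.le hu1 (by norm_num)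
    refine ⟨γ1 * u ^ (1 / 4 : ℝ), ⟨?_, ?_⟩, ?_⟩
    · have := mul_pos hγ1pos hr0
      linarith
    · exact mul_lt_of_lt_one_right hγ1pos hr1
    · have e : (γ1 * u ^ (1 / 4 : ℝ)) ^ 4 / T = u := by
        rw [mul_pow, hr4, ← hT]; field_simp
      rw [hW, hR, e]
      refine hlt.trans_le ?_
      have ht := (alt_tail (fun n => Ac ν T n * u ^ n)
        (fun n => mul_nonneg (hA n) (pow_nonneg hu0.le n)) (fun k hk => by
          show Ac ν T (k + 1) * u ^ (k + 1) ≤ Ac ν T k * u ^ k / 2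
          have a1 := hh k hk
          have a2 : u ^ (k + 1) ≤ u ^ k := pow_le_pow_of_le_one hu0.le hu1.le (by omega)
          calc _ ≤ Ac ν T k / 2 * u ^ k :=
                mul_le_mul a1 a2 (by positivity) (by have := hA k; linarith)
            _ = _ := by ring)).1
      simp only [pow_zero, pow_one, mul_one, Ac_zero ν T hν1] at ht
      exact ht
end

section
/- Let ν > -1, let r > 0, and let α, β be real numbers. Then the two-sided Redheffer-type inequality ((r² + x²)/(r² - x²))^α ≤ λ_ν(x) ≤ ((r² + x²)/(r² - x²))^β holds for all real x with |x| < r if and only if α ≤ 0 and β ≥ 3r²/(8(ν+1)). -/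
open Real Set

theorem aux_gamma (m : ℝ) (hm : 0 < m) (n : ℕ) :
    m ^ n * Real.Gamma m ≤ Real.Gamma (m + n) := by
  induction n with
  | zero => simp
  | succ k ih =>
    have hk : (0 : ℝ) ≤ k := Nat.cast_nonneg k
    have h1 : Real.Gamma (m + (k + 1 : ℕ)) = (m + k) * Real.Gamma (m + k) := by
      rw [← Real.Gamma_add_one (by positivity)]
      congr 1
      push_cast
      ring
    have hG := Real.Gamma_pos_of_pos (show 0 < m + k by positivity)
    rw [h1]
    calc m ^ (k + 1) * Real.Gamma m = m * (m ^ k * Real.Gamma m) := by ring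
      _ ≤ m * Real.Gamma (m + k) := by gcongr
      _ ≤ (m + k) * Real.Gamma (m + k) := by gcongr; linarith

theorem aux_three (n : ℕ) : 2 * (n : ℝ) + 1 ≤ 3 ^ n := by
  have := one_add_mul_le_pow (show (-2 : ℝ) ≤ 2 by norm_num) n
  norm_num at this
  linarith

theorem aux_nonneg (ν : ℝ) (hν : -1 < ν) (x : ℝ) (n : ℕ) :
    0 ≤ (2 * (n : ℝ) + 1) * Real.Gamma (ν + 1) * x ^ (2 * n) /
    ((2 : ℝ) ^ (2 * n) * (n.factorial : ℝ) * Real.Gamma (ν + n + 1)) := by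
  have hn : (0 : ℝ) ≤ n := Nat.cast_nonneg n
  have h1 := Real.Gamma_pos_of_pos (show 0 < ν + 1 by linarith)
  have h2 := Real.Gamma_pos_of_pos (show 0 < ν + n + 1 by linarith)
  have h3 : 0 ≤ x ^ (2 * n) := by rw [pow_mul]; positivity
  positivity

theorem aux_le (ν : ℝ) (hν : -1 < ν) (x : ℝ) (n : ℕ) :
    (2 * (n : ℝ) + 1) * Real.Gamma (ν + 1) * x ^ (2 * n) /
    ((2 : ℝ) ^ (2 * n) * (n.factorial : ℝ) * Real.Gamma (ν + n + 1)) ≤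
      (3 * x ^ 2 / (4 * (ν + 1))) ^ n / (n.factorial : ℝ) := by
  have hn : (0 : ℝ) ≤ n := Nat.cast_nonneg n
  have hm : 0 < ν + 1 := by linarith
  have h1 := Real.Gamma_pos_of_pos hm
  have h3 : 0 ≤ x ^ (2 * n) := by rw [pow_mul]; positivity
  have h4 := aux_gamma (ν + 1) hm n
  have e : ν + n + 1 = ν + 1 + n := by ring
  have hf : (0 : ℝ) < n.factorial := by exact_mod_cast n.factorial_pos
  rw [e]
  calc _ ≤ 3 ^ n * Real.Gamma (ν + 1) * x ^ (2 * n) /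
      ((2 : ℝ) ^ (2 * n) * (n.factorial : ℝ) * ((ν + 1) ^ n * Real.Gamma (ν + 1))) := by
        have := aux_three n
        gcongr
    _ = _ := by
      rw [div_pow, mul_pow, mul_pow, pow_mul, pow_mul]
      norm_num
      field_simp

theorem aux_summable (ν : ℝ) (hν : -1 < ν) (x : ℝ) :
    Summable (fun n : ℕ => (2 * (n : ℝ) + 1) * Real.Gamma (ν + 1) * x ^ (2 * n) /
    ((2 : ℝ) ^ (2 * n) * (n.factorial : ℝ) * Real.Gamma (ν + n + 1))) :=
  Summable.of_nonneg_of_le (aux_nonneg ν hν x) (aux_le ν hν x)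
    (Real.summable_pow_div_factorial _)

theorem aux_upper (ν : ℝ) (hν : -1 < ν) (x : ℝ) :
    lamDini ν x ≤ Real.exp (3 * x ^ 2 / (4 * (ν + 1))) := by
  rw [Real.exp_eq_exp_ℝ, NormedSpace.exp_eq_tsum_div]
  exact (aux_summable ν hν x).tsum_le_tsum (aux_le ν hν x) (Real.summable_pow_div_factorial _)

theorem aux_lower (ν : ℝ) (hν : -1 < ν) (x : ℝ) :
    1 + 3 * x ^ 2 / (4 * (ν + 1)) ≤ lamDini ν x := by
  have h := (aux_summable ν hν x).sum_le_tsum (Finset.range 2) (fun i _ => aux_nonneg ν hν x i)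
  refine le_trans (le_of_eq ?_) h
  have hm : 0 < ν + 1 := by linarith
  have h1 := Real.Gamma_pos_of_pos hm
  have h2 := Real.Gamma_add_one hm.ne'
  simp only [Finset.sum_range_succ, Finset.sum_range_zero]
  norm_num [h2]
  field_simp

theorem aux_base (r x : ℝ) (hx : |x| < r) :
    0 < r ^ 2 - x ^ 2 := by
  have := sq_lt_sq' (neg_lt_of_abs_lt hx) (lt_of_abs_lt hx)
  linarith

/-- every `y ≥ 1` is attained by the Redheffer ratio -/
theorem aux_surj (r : ℝ) (hr : 0 < r) (y : ℝ) (hy : 1 ≤ y) :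
    ∃ x : ℝ, |x| < r ∧ x ^ 2 = r ^ 2 * ((y - 1) / (y + 1)) ∧
      (r ^ 2 + x ^ 2) / (r ^ 2 - x ^ 2) = y := by
  have hs0 : 0 ≤ (y - 1) / (y + 1) := div_nonneg (by linarith) (by linarith)
  have hs1 : (y - 1) / (y + 1) < 1 := by rw [div_lt_one (by linarith)]; linarith
  have hx2 : (r * √((y - 1) / (y + 1))) ^ 2 = r ^ 2 * ((y - 1) / (y + 1)) := by
    rw [mul_pow, Real.sq_sqrt hs0]
  refine ⟨r * √((y - 1) / (y + 1)), ?_, hx2, ?_⟩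
  · apply abs_lt_of_sq_lt_sq _ hr.le
    rw [hx2]
    have : 0 < r ^ 2 := by positivity
    nlinarith
  · rw [hx2]
    have h1 : y + 1 ≠ 0 := by linarith
    have h2 : r ^ 2 - r ^ 2 * ((y - 1) / (y + 1)) = r ^ 2 * (2 / (y + 1)) := by
      field_simp; ring
    have h3 : r ^ 2 + r ^ 2 * ((y - 1) / (y + 1)) = r ^ 2 * (2 * y / (y + 1)) := by
      field_simp; ring
    rw [h2, h3]
    field_simp

theorem aux_log (s : ℝ) (h0 : 0 ≤ s) (h1 : s < 1) :
    2 * s ≤ Real.log ((1 + s) / (1 - s)) := by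
  have h := Real.hasSum_log_sub_log_of_abs_lt_one (x := s) (by rw [abs_lt]; constructor <;> linarith)
  rw [Real.log_div (by linarith) (by linarith)]
  have := h.summable.sum_le_tsum (Finset.range 1) (fun i _ => by positivity)
  rw [h.tsum_eq] at this
  simpa using this

theorem aux_deriv (B b : ℝ) (h : ∀ y : ℝ, 1 ≤ y → 1 + 2 * B * ((y - 1) / (y + 1)) ≤ y ^ b) :
    B ≤ b := by
  have hd : HasDerivAt (fun y : ℝ => y ^ b - (1 + 2 * B * ((y - 1) / (y + 1)))) (b - B) 1 := by
    have h1 := Real.hasDerivAt_rpow_const (x := 1) (p := b) (Or.inl one_ne_zero)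
    have h2 := (((hasDerivAt_id (1 : ℝ)).sub_const 1).div ((hasDerivAt_id (1 : ℝ)).add_const 1)
      (by norm_num)).const_mul (2 * B)
    have h3 := h1.sub (h2.const_add 1)
    refine h3.congr_deriv ?_
    norm_num
    ring
  have ht := hd.tendsto_slope.mono_left (nhdsWithin_mono (1 : ℝ) (s := Set.Ioi 1)
    (fun y (hy : 1 < y) => hy.ne'))
  have : 0 ≤ b - B := by
    refine ge_of_tendsto ht ?_
    filter_upwards [self_mem_nhdsWithin] with y hy
    have hy' : 1 < y := hy
    rw [slope_def_field]
    have := h y hy'.le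
    apply div_nonneg
    · norm_num
      linarith
    · linarith
  linarith

/-- Two-sided Redheffer-type inequality for the normalized modified Dini function:
it holds on `|x| < r` iff `α ≤ 0` and `β ≥ 3r²/(8(ν+1))`. -/
theorem lamDini_redheffer_iff (ν : ℝ) (hν : -1 < ν) (r : ℝ) (hr : 0 < r) (a b : ℝ) :
    (∀ x : ℝ, |x| < r →
      ((r ^ 2 + x ^ 2) / (r ^ 2 - x ^ 2)) ^ a ≤ lamDini ν x ∧
        lamDini ν x ≤ ((r ^ 2 + x ^ 2) / (r ^ 2 - x ^ 2)) ^ b) ↔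
    (a ≤ 0 ∧ 3 * r ^ 2 / (8 * (ν + 1)) ≤ b) := by
  have hm : 0 < ν + 1 := by linarith
  constructor
  · intro h
    constructor
    · by_contra! ha
      set C := Real.exp (3 * r ^ 2 / (4 * (ν + 1))) with hC
      have hC0 : 0 < C := Real.exp_pos _
      obtain ⟨x, hx, -, hxy⟩ := aux_surj r hr ((C + 1) ^ (1 / a))
        (Real.one_le_rpow (by linarith) (by positivity))
      have h1 := (h x hx).1
      rw [hxy, ← Real.rpow_mul (by linarith), one_div, inv_mul_cancel₀ ha.ne', Real.rpow_one] at h1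
      have h2 := aux_upper ν hν x
      have h3 := aux_base r x hx
      have h4 : Real.exp (3 * x ^ 2 / (4 * (ν + 1))) ≤ C := by
        rw [hC, Real.exp_le_exp]
        gcongr 3 * ?_ / _
        linarith
      linarith
    · apply aux_deriv
      intro y hy
      obtain ⟨x, hx, hx2, hxy⟩ := aux_surj r hr y hy
      have h1 := (h x hx).2
      rw [hxy] at h1
      refine le_trans (le_trans (le_of_eq ?_) (aux_lower ν hν x)) h1
      rw [hx2]
      have : y + 1 ≠ 0 := by linarith
      field_simp
      ring
  · rintro ⟨ha, hb⟩ x hx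
    have hb0 := aux_base r x hx
    have hr2 : 0 < r ^ 2 := by positivity
    have hy : 1 ≤ (r ^ 2 + x ^ 2) / (r ^ 2 - x ^ 2) := by
      rw [le_div_iff₀ hb0]
      nlinarith [sq_nonneg x]
    constructor
    · refine (Real.rpow_le_one_of_one_le_of_nonpos hy ha).trans (le_trans ?_ (aux_lower ν hν x))
      have : 0 ≤ 3 * x ^ 2 / (4 * (ν + 1)) := by positivity
      linarith
    · refine (aux_upper ν hν x).trans ?_
      refine le_trans ?_ (Real.rpow_le_rpow_of_exponent_le hy hb)
      rw [Real.rpow_def_of_pos (by linarith), Real.exp_le_exp]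
      have hl := aux_log (x ^ 2 / r ^ 2) (by positivity) (by rw [div_lt_one hr2]; linarith)
      have e : (1 + x ^ 2 / r ^ 2) / (1 - x ^ 2 / r ^ 2) = (r ^ 2 + x ^ 2) / (r ^ 2 - x ^ 2) := by
        have h1 : 1 - x ^ 2 / r ^ 2 = (r ^ 2 - x ^ 2) / r ^ 2 := by field_simp
        have h2 : 1 + x ^ 2 / r ^ 2 = (r ^ 2 + x ^ 2) / r ^ 2 := by field_simp
        rw [h1, h2, div_div_div_cancel_right₀ hr2.ne']
      rw [e] at hl
      calc 3 * x ^ 2 / (4 * (ν + 1)) = 2 * (x ^ 2 / r ^ 2) * (3 * r ^ 2 / (8 * (ν + 1))) := by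
            field_simp
            ring
        _ ≤ _ := by gcongr
end

section
/- Let ν > -1, let j_{ν,1} be the smallest positive zero of 𝒥_ν, and suppose j_{ν,1}² ≥ 8(ν+1) (which holds exactly for ν ≥ ν₀, where ν₀ ∈ (1,2) is the unique positive root of j_{ν,1}² = 8(ν+1)). Then for all real x with |x| < j_{ν,1}: 𝒥_ν(x) ≤ (j_{ν,1}² - x²)/(j_{ν,1}² + x²) and 𝒥_{ν+1}(x)/𝒥_ν(x) ≥ ((j_{ν,1}² + x²)/(j_{ν,1}² - x²))^{1/(ν+2)}. -/
open Real Set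

/-- Coefficients of the normalized Bessel series in the variable `t = x^2`. -/
noncomputable def auxC (a : ℝ) (n : ℕ) : ℝ :=
  (-1 : ℝ) ^ n * Real.Gamma a / ((4 : ℝ) ^ n * (n.factorial : ℝ) * Real.Gamma (a + n))

/-- The normalized Bessel function in the variable `t = x^2`. -/
noncomputable def auxF (a t : ℝ) : ℝ := ∑' n : ℕ, auxC a n * t ^ n

lemma Jcal_eq_auxF (ν x : ℝ) : Jcal ν x = auxF (ν + 1) (x ^ 2) := by
  unfold Jcal auxF auxC
  congr 1
  ext n
  have h4 : (2 : ℝ) ^ (2 * n) = 4 ^ n := by rw [pow_mul]; norm_num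
  rw [h4, pow_mul, show ν + n + 1 = ν + 1 + n by ring]
  ring

lemma auxG_pos {a : ℝ} (ha : 0 < a) (n : ℕ) : 0 < Real.Gamma (a + n) :=
  Real.Gamma_pos_of_pos (by positivity)

lemma auxC_deriv {a : ℝ} (ha : 0 < a) (n : ℕ) :
    ((n : ℝ) + 1) * auxC a (n + 1) = -(1 / (4 * a)) * auxC (a + 1) n := by
  unfold auxC
  have h1 := (auxG_pos (a := a + 1) (by linarith) n).ne'
  rw [Real.Gamma_add_one ha.ne', Nat.factorial_succ]
  push_cast
  rw [show a + ((n : ℝ) + 1) = a + 1 + n by ring]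
  have h2 : (n.factorial : ℝ) ≠ 0 := by positivity
  field_simp
  ring

lemma auxC_succ {a : ℝ} (ha : 0 < a) (n : ℕ) :
    auxC a (n + 1) = -(1 / (4 * (n + 1) * (a + n))) * auxC a n := by
  unfold auxC
  have h1 := (auxG_pos ha n).ne'
  have h3 : a + n ≠ 0 := by positivity
  rw [Nat.factorial_succ]
  push_cast
  rw [← add_assoc, Real.Gamma_add_one h3]
  have h2 : (n.factorial : ℝ) ≠ 0 := by positivity
  field_simp
  ring

lemma auxC_zero {a : ℝ} (ha : 0 < a) : auxC a 0 = 1 := by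
  unfold auxC
  have h1 := (auxG_pos ha 0).ne'
  simp only [Nat.cast_zero, add_zero] at h1
  simp [h1]

lemma auxC_rec {a : ℝ} (ha : 0 < a) (n : ℕ) :
    auxC (a + 1) (n + 1) - auxC a (n + 1) = 1 / (4 * a * (a + 1)) * auxC (a + 2) n := by
  have h1 := (auxG_pos (a := a + 2) (by linarith) n).ne'
  have h3 : a + 1 + n ≠ 0 := by positivity
  have e : Real.Gamma (a + 2 + n) = (a + 1 + n) * Real.Gamma (a + 1 + n) := by
    rw [← Real.Gamma_add_one h3]; congr 1; ring
  have e2 : Real.Gamma (a + 2) = (a + 1) * (a * Real.Gamma a) := by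
    rw [← Real.Gamma_add_one ha.ne', ← Real.Gamma_add_one (by positivity)]; congr 1; ring
  have h4 := (auxG_pos (a := a + 1) (by linarith) n).ne'
  unfold auxC
  rw [Real.Gamma_add_one ha.ne', e2, Nat.factorial_succ]
  push_cast
  rw [show a + 1 + ((n : ℝ) + 1) = a + 2 + n by ring, show a + ((n : ℝ) + 1) = a + 1 + n by ring, e]
  have h2 : (n.factorial : ℝ) ≠ 0 := by positivity
  field_simp
  ring

lemma auxC_ne {a : ℝ} (ha : 0 < a) (n : ℕ) : auxC a n ≠ 0 := by
  unfold auxC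
  have h1 := (auxG_pos ha n).ne'
  have h2 := (Real.Gamma_pos_of_pos ha).ne'
  have h3 : (n.factorial : ℝ) ≠ 0 := by positivity
  positivity

lemma auxSummable {a : ℝ} (ha : 0 < a) (t : ℝ) : Summable (fun n : ℕ => auxC a n * t ^ n) := by
  by_cases ht : t = 0
  · subst ht
    apply summable_of_ne_finset_zero (s := {0})
    intro n hn
    simp at hn
    simp [hn]
  apply summable_of_ratio_test_tendsto_lt_one (l := 0) (by norm_num)
  · filter_upwards with n
    exact mul_ne_zero (auxC_ne ha n) (pow_ne_zero _ ht)
  · have e : ∀ n : ℕ, ‖auxC a (n + 1) * t ^ (n + 1)‖ / ‖auxC a n * t ^ n‖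
        = (|t| / 4) * (1 / ((n : ℝ) + 1)) * (1 / (a + n)) := by
      intro n
      have h1 := auxC_ne ha n
      have h2 : 0 < a + n := by positivity
      have h3 : 0 < (n : ℝ) + 1 := by positivity
      rw [auxC_succ ha, ← norm_div, pow_succ]
      rw [show -(1 / (4 * ((n:ℝ) + 1) * (a + n))) * auxC a n * (t ^ n * t) / (auxC a n * t ^ n)
        = -(t * (1 / (4 * ((n:ℝ) + 1) * (a + n)))) by field_simp]
      rw [norm_neg, Real.norm_eq_abs, abs_mul, abs_of_pos (a := 1 / (4 * ((n:ℝ) + 1) * (a + n)))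
        (by positivity)]
      field_simp
    simp_rw [e]
    have l1 : Filter.Tendsto (fun n : ℕ => 1 / ((n : ℝ) + 1)) Filter.atTop (nhds 0) :=
      tendsto_one_div_add_atTop_nhds_zero_nat
    have l2 : Filter.Tendsto (fun n : ℕ => 1 / (a + (n : ℝ))) Filter.atTop (nhds 0) := by
      simp_rw [one_div]
      exact tendsto_inv_atTop_zero.comp
        (Filter.tendsto_atTop_add_const_left _ _ tendsto_natCast_atTop_atTop)
    simpa using (l1.const_mul (|t| / 4)).mul l2

lemma auxF_zero {a : ℝ} (ha : 0 < a) : auxF a 0 = 1 := by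
  unfold auxF
  rw [tsum_eq_single 0]
  · simp [auxC_zero ha]
  · intro n hn; simp [hn]

lemma auxF_hasDerivAt {a : ℝ} (ha : 0 < a) (t : ℝ) :
    HasDerivAt (auxF a) (-(1 / (4 * a)) * auxF (a + 1) t) t := by
  set r := |t| + 1 with hr
  have hr0 : 0 < r := by positivity
  have key : ∀ n : ℕ, ∀ y : ℝ, ((n : ℝ) + 1) * (auxC a (n + 1) * y ^ n)
      = -(1 / (4 * a)) * (auxC (a + 1) n * y ^ n) := by
    intro n y
    linear_combination (y ^ n) * auxC_deriv ha n
  have hs : Summable (fun n : ℕ => |auxC a n * (n * r ^ (n - 1))|) := by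
    rw [← summable_nat_add_iff 1]
    have := ((auxSummable (a := a + 1) (by linarith) r).mul_left (-(1 / (4 * a)))).abs
    refine this.congr fun n => ?_
    rw [← key]
    congr 1
    rw [Nat.add_sub_cancel]
    push_cast
    ring
  have h := hasDerivAt_tsum_of_isPreconnected (𝕜 := ℝ) (F := ℝ) (t := Metric.ball 0 r)
    (g := fun (n : ℕ) (y : ℝ) => auxC a n * y ^ n)
    (g' := fun (n : ℕ) (y : ℝ) => auxC a n * (n * y ^ (n - 1)))
    (y₀ := 0) (y := t) hs Metric.isOpen_ball (convex_ball 0 r).isPreconnected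
    (fun n y _ => (hasDerivAt_pow n y).const_mul _)
    (by
      intro n y hy
      rw [Real.norm_eq_abs, abs_mul, abs_mul (auxC a n), abs_mul, abs_mul (n : ℝ), abs_pow, abs_pow,
        abs_of_pos hr0]
      have : |y| ≤ r := by
        have := mem_ball_zero_iff.1 hy
        rw [Real.norm_eq_abs] at this; exact this.le
      gcongr)
    (by simpa using hr0) (auxSummable ha 0) (by simp [hr])
  have e : (∑' n : ℕ, auxC a n * (n * t ^ (n - 1))) = -(1 / (4 * a)) * auxF (a + 1) t := by
    have hs' : Summable (fun n : ℕ => auxC a n * (n * t ^ (n - 1))) := by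
      rw [← summable_nat_add_iff 1]
      refine ((auxSummable (a := a + 1) (by linarith) t).mul_left (-(1 / (4 * a)))).congr
        fun n => ?_
      rw [← key]
      rw [Nat.add_sub_cancel]
      push_cast
      ring
    rw [hs'.tsum_eq_zero_add]
    unfold auxF
    rw [← tsum_mul_left]
    simp only [Nat.cast_zero, zero_mul, mul_zero, zero_add]
    congr 1
    ext n
    rw [← key]
    rw [Nat.add_sub_cancel]
    push_cast
    ring
  rw [← e]
  exact h

lemma auxF_rec {a : ℝ} (ha : 0 < a) (t : ℝ) :
    auxF (a + 1) t - auxF a t = t * (1 / (4 * a * (a + 1))) * auxF (a + 2) t := by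
  have s1 := auxSummable (a := a + 1) (by linarith) t
  have s0 := auxSummable ha t
  unfold auxF
  rw [s1.tsum_eq_zero_add, s0.tsum_eq_zero_add, ← tsum_mul_left]
  rw [auxC_zero ha, auxC_zero (by linarith : 0 < a + 1), add_sub_add_left_eq_sub]
  rw [← Summable.tsum_sub ((summable_nat_add_iff 1).2 s1) ((summable_nat_add_iff 1).2 s0)]
  congr 1
  ext n
  linear_combination t ^ (n + 1) * auxC_rec ha n

lemma aux_mono {a l u : ℝ} (ha : 0 < a) (hl : 0 ≤ l) (hlu : l ≤ u) {φ φ' : ℝ → ℝ}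
    (hd : ∀ t, 0 ≤ t → HasDerivAt φ (φ' t) t)
    (h : ∀ t, l < t → t < u → 0 ≤ t * φ' t + a * φ t) :
    l ^ a * φ l ≤ u ^ a * φ u := by
  have hm : MonotoneOn (fun t : ℝ => t ^ a * φ t) (Icc l u) := by
    apply monotoneOn_of_hasDerivWithinAt_nonneg (convex_Icc l u)
      (f' := fun t => a * t ^ (a - 1) * φ t + t ^ a * φ' t)
    · intro t ht
      have h1 := (hd t (hl.trans ht.1)).continuousAt
      have h2 : ContinuousAt (fun t : ℝ => t ^ a) t :=
        Real.continuousAt_rpow_const t a (Or.inr ha.le)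
      exact (h2.mul h1).continuousWithinAt
    · intro t ht
      rw [interior_Icc] at ht
      have ht0 : 0 < t := hl.trans_lt ht.1
      exact ((Real.hasDerivAt_rpow_const (Or.inl ht0.ne')).mul (hd t ht0.le)).hasDerivWithinAt
    · intro t ht
      rw [interior_Icc] at ht
      have ht0 : 0 < t := hl.trans_lt ht.1
      have e : t ^ a = t ^ (a - 1) * t := by
        rw [← Real.rpow_add_one ht0.ne']; congr 1; ring
      have := mul_nonneg (Real.rpow_nonneg ht0.le (a - 1)) (h t ht.1 ht.2)
      rw [e]; linarith
  exact hm (left_mem_Icc.2 hlu) (right_mem_Icc.2 hlu) hlu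

lemma aux_nonneg_s19 {a u : ℝ} (ha : 0 < a) (hu : 0 < u) {φ φ' : ℝ → ℝ}
    (hd : ∀ t, 0 ≤ t → HasDerivAt φ (φ' t) t)
    (h : ∀ t, 0 < t → t < u → 0 ≤ t * φ' t + a * φ t) : 0 ≤ φ u := by
  have := aux_mono ha le_rfl hu.le hd h
  rw [Real.zero_rpow ha.ne', zero_mul] at this
  exact nonneg_of_mul_nonneg_right this (Real.rpow_pos_of_pos hu a)

theorem aux_main {a T : ℝ} (ha : 0 < a) (hT : 0 < T) (h8 : 8 * a ≤ T) {f g g' : ℝ → ℝ}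
    (hf : ∀ t, HasDerivAt f (-(1 / (4 * a)) * g t) t)
    (hg : ∀ t, HasDerivAt g (g' t) t)
    (hg' : ∀ t, t * g' t = a * (f t - g t))
    (f0 : f 0 = 1) (g0 : g 0 = 1) (fT : f T = 0) (fpos : ∀ t, 0 ≤ t → t < T → 0 < f t)
    {t : ℝ} (ht0 : 0 ≤ t) (htT : t < T) :
    f t ≤ (T - t) / (T + t) ∧ 0 < g t ∧ 0 ≤ (a + 1) * Real.log (g t) - a * Real.log (f t) := by
  have gnn : ∀ t, 0 < t → t < T → 0 ≤ g t := by
    intro t h0 h1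
    refine aux_nonneg_s19 ha h0 (fun t _ => hg t) fun s hs hst => ?_
    rw [hg']
    nlinarith [fpos s hs.le (hst.trans h1)]
  have gf : ∀ t, 0 < t → t < T → 0 ≤ g t - f t := by
    intro t h0 h1
    refine aux_nonneg_s19 ha h0 (φ := fun t => g t - f t) (fun t _ => (hg t).sub (hf t))
      fun s hs hst => ?_
    have e : s * (g' s - -(1 / (4 * a)) * g s) + a * (g s - f s) = s * g s / (4 * a) := by
      linear_combination hg' s
    rw [e]
    have := gnn s hs (hst.trans h1)
    positivity
  have gpos : ∀ t, 0 ≤ t → t < T → 0 < g t := by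
    intro t h0 h1
    rcases h0.eq_or_lt with h | h
    · rw [← h, g0]; norm_num
    · linarith [gf t h h1, fpos t h0 h1]
  have K : ∀ t, 0 < t → t < T →
      0 ≤ t * g t ^ 2 - 4 * a * (a + 1) * (g t * f t) + 4 * a * (a + 1) * f t ^ 2 := by
    intro t h0 h1
    refine aux_nonneg_s19 ha h0
      (φ := fun t => t * g t ^ 2 - 4 * a * (a + 1) * (g t * f t) + 4 * a * (a + 1) * f t ^ 2)
      (fun t _ => (((hasDerivAt_id t).mul ((hg t).pow 2)).sub
        (((hg t).mul (hf t)).const_mul _)).add (((hf t).pow 2).const_mul _))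
      fun s hs hst => ?_
    have h2 := gpos s hs.le (hst.trans h1)
    have h3 := gf s hs (hst.trans h1)
    have : 0 ≤ 2 * s * g s * (g s - f s) := by positivity
    refine this.trans_eq ?_
    simp only [id, Nat.cast_ofNat, pow_one, Nat.add_one_sub_one, Pi.pow_apply]
    have e := hg' s
    field_simp
    linear_combination (-(2 * s * g s) + 4 * a * (a + 1) * f s) * e
  refine ⟨?_, gpos t ht0 htT, ?_⟩
  · -- Redheffer part
    have hTt : ∀ s, 0 ≤ s → 0 < T + s := fun s hs => by linarith
    have dR : ∀ s, 0 ≤ s → HasDerivAt (fun s => (T - s) / (T + s)) (-2 * T / (T + s) ^ 2) s := by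
      intro s hs
      have := ((hasDerivAt_id s).const_sub T).div ((hasDerivAt_id s).const_add T) (hTt s hs).ne'
      refine this.congr_deriv ?_
      simp only [id]; congr 1; ring
    have dR' : ∀ s, 0 ≤ s → HasDerivAt (fun s => -2 * T / (T + s) ^ 2) (4 * T / (T + s) ^ 3) s := by
      intro s hs
      have h1 := hTt s hs
      have := (hasDerivAt_const s (-2 * T)).div (((hasDerivAt_id s).const_add T).pow 2)
        (pow_ne_zero 2 h1.ne')
      refine this.congr_deriv ?_
      simp only [id, Pi.pow_apply]
      field_simp
      norm_num
      ring
    set φ : ℝ → ℝ := fun s => 1 / (4 * a) * g s * ((T - s) / (T + s)) + f s * (-2 * T / (T + s) ^ 2)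
      with hφ
    set N : ℝ → ℝ := fun s => (T - 8 * a) * T ^ 2 + (T + 16 - 8 * a) * T * s - s ^ 2 * T - s ^ 3
      with hN
    have dφ : ∀ s, 0 ≤ s → HasDerivAt φ ((1 / (4 * a) * g' s * ((T - s) / (T + s)) +
        1 / (4 * a) * g s * (-2 * T / (T + s) ^ 2)) + (-(1 / (4 * a)) * g s * (-2 * T / (T + s) ^ 2)
          + f s * (4 * T / (T + s) ^ 3))) s := by
      intro s hs
      exact (((hg s).const_mul _).mul (dR s hs)).add ((hf s).mul (dR' s hs))
    have eφ : ∀ s, 0 ≤ s → s * ((1 / (4 * a) * g' s * ((T - s) / (T + s)) +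
        1 / (4 * a) * g s * (-2 * T / (T + s) ^ 2)) + (-(1 / (4 * a)) * g s * (-2 * T / (T + s) ^ 2)
          + f s * (4 * T / (T + s) ^ 3))) + a * φ s = f s * N s / (4 * (T + s) ^ 3) := by
      intro s hs
      have h1 := hTt s hs
      simp only [hφ, hN]
      have e := hg' s
      field_simp
      linear_combination (T - s) * (T + s) ^ 2 * e
    have φT : φ T = 0 := by simp [hφ, fT]
    -- sign pattern of N
    have hNs : ∀ s s', 0 < s → s ≤ s' → N s ≤ 0 → N s' ≤ 0 := by
      intro s s' hs hss hn
      have h1 : N s' * s ^ 2 ≤ N s * s' ^ 2 := by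
        simp only [hN]
        have hs' : 0 < s' := by linarith
        have a1 : 0 ≤ (T - 8 * a) * T ^ 2 * ((s' - s) * (s' + s)) := by
          have : 0 ≤ T - 8 * a := by linarith
          have : 0 ≤ s' - s := by linarith
          positivity
        have a2 : 0 ≤ (T + 16 - 8 * a) * T * (s * s' * (s' - s)) := by
          have : 0 ≤ T + 16 - 8 * a := by linarith
          have : 0 ≤ s' - s := by linarith
          positivity
        have a3 : 0 ≤ s ^ 2 * s' ^ 2 * (s' - s) := by
          have : 0 ≤ s' - s := by linarith
          positivity
        nlinarith
      by_contra hc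
      push Not at hc
      have : 0 < N s' * s ^ 2 := by positivity
      nlinarith [mul_nonneg (neg_nonneg.2 hn) (sq_nonneg s')]
    have φnn : ∀ s, 0 < s → s < T → 0 ≤ φ s := by
      intro s hs hsT
      by_cases hn : 0 ≤ N s
      · refine aux_nonneg_s19 ha hs dφ fun r hr hrs => ?_
        rw [eφ r hr.le]
        have h1 := fpos r hr.le (hrs.trans hsT)
        have h2 := hTt r hr.le
        have h3 : 0 ≤ N r := by
          by_contra hc
          push Not at hc
          have a1 : 0 ≤ (T - 8 * a) * T ^ 2 * ((s - r) * (s + r)) := by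
            have : 0 ≤ T - 8 * a := by linarith
            have : 0 ≤ s - r := by linarith
            positivity
          have a2 : 0 ≤ (T + 16 - 8 * a) * T * (r * s * (s - r)) := by
            have : 0 ≤ T + 16 - 8 * a := by linarith
            have : 0 ≤ s - r := by linarith
            positivity
          have a3 : 0 ≤ r ^ 2 * s ^ 2 * (s - r) := by
            have : 0 ≤ s - r := by linarith
            positivity
          have a4 : N s * r ^ 2 ≤ N r * s ^ 2 := by
            simp only [hN]; nlinarith
          have : 0 ≤ N s * r ^ 2 := by positivity
          have : N r * s ^ 2 < 0 := mul_neg_of_neg_of_pos hc (by positivity)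
          linarith
        positivity
      · push Not at hn
        have := aux_mono ha hs.le hsT.le (φ := fun s => -φ s) (fun r hr => (dφ r hr).neg)
          (fun r hr hrT => by
            have hr0 := hs.trans hr
            have h1 := fpos r hr0.le hrT
            have h2 := hTt r hr0.le
            have h3 := hNs s r hs hr.le hn.le
            have h4 := eφ r hr0.le
            have h5 : f r * N r / (4 * (T + r) ^ 3) ≤ 0 :=
              div_nonpos_of_nonpos_of_nonneg (mul_nonpos_of_nonneg_of_nonpos h1.le h3)
                (by positivity)
            linarith)
        rw [φT] at this
        simp only [neg_zero, mul_zero, mul_neg, Left.neg_nonpos_iff] at this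
        exact nonneg_of_mul_nonneg_right this (Real.rpow_pos_of_pos hs a)
    have hm : MonotoneOn (fun s => (T - s) / (T + s) / f s) (Icc 0 t) := by
      apply monotoneOn_of_hasDerivWithinAt_nonneg (convex_Icc 0 t)
        (f' := fun s => ((-2 * T / (T + s) ^ 2) * f s - (T - s) / (T + s) * (-(1 / (4 * a)) * g s))
          / f s ^ 2)
      · intro s hs
        exact ((dR s hs.1).div (hf s)
          (fpos s hs.1 (hs.2.trans_lt htT)).ne').continuousAt.continuousWithinAt
      · intro s hs
        rw [interior_Icc] at hs
        exact ((dR s hs.1.le).div (hf s)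
          (fpos s hs.1.le (hs.2.trans htT)).ne').hasDerivWithinAt
      · intro s hs
        rw [interior_Icc] at hs
        have := φnn s hs.1 (hs.2.trans htT)
        apply div_nonneg _ (sq_nonneg _)
        simp only [hφ] at this
        linarith
    have := hm (left_mem_Icc.2 ht0) (right_mem_Icc.2 ht0) ht0
    simp only [f0, sub_zero, add_zero, div_one, div_self hT.ne'] at this
    rwa [le_div_iff₀ (fpos t ht0 htT), one_mul] at this
  · have hm : MonotoneOn (fun s => (a + 1) * Real.log (g s) - a * Real.log (f s)) (Icc 0 t) := by
      have d : ∀ s, 0 ≤ s → s < T → HasDerivAt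
          (fun s => (a + 1) * Real.log (g s) - a * Real.log (f s))
          ((a + 1) * (g' s / g s) - a * (-(1 / (4 * a)) * g s / f s)) s := fun s h0 h1 =>
        (((hg s).log (gpos s h0 h1).ne').const_mul _).sub
          (((hf s).log (fpos s h0 h1).ne').const_mul _)
      apply monotoneOn_of_hasDerivWithinAt_nonneg (convex_Icc 0 t)
        (f' := fun s => (a + 1) * (g' s / g s) - a * (-(1 / (4 * a)) * g s / f s))
      · intro s hs
        exact (d s hs.1 (hs.2.trans_lt htT)).continuousAt.continuousWithinAt
      · intro s hs
        rw [interior_Icc] at hs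
        exact (d s hs.1.le (hs.2.trans htT)).hasDerivWithinAt
      · intro s hs
        rw [interior_Icc] at hs
        have h0 := hs.1
        have hsT := hs.2.trans htT
        have h1 := gpos s h0.le hsT
        have h2 := fpos s h0.le hsT
        have h3 : (a + 1) * (g' s / g s) - a * (-(1 / (4 * a)) * g s / f s)
          = (s * g s ^ 2 - 4 * a * (a + 1) * (g s * f s) + 4 * a * (a + 1) * f s ^ 2)
            / (4 * s * g s * f s) := by
          have e := hg' s
          field_simp
          linear_combination 4 * f s * (a + 1) * e
        rw [h3]
        have := K s h0 hsT
        positivity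
    have := hm (left_mem_Icc.2 ht0) (right_mem_Icc.2 ht0) ht0
    simpa [f0, g0] using this

/-- New Redheffer-type inequalities for the normalized Bessel function when
`j_{ν,1}² ≥ 8(ν+1)`. -/
theorem Jcal_redheffer_new (ν : ℝ) (hν : -1 < ν) (j1 : ℝ)
    (hj1pos : 0 < j1) (hj1zero : Jcal ν j1 = 0)
    (hj1min : ∀ x : ℝ, 0 < x → Jcal ν x = 0 → j1 ≤ x)
    (hj1sq : 8 * (ν + 1) ≤ j1 ^ 2) :
    ∀ x : ℝ, |x| < j1 →
      Jcal ν x ≤ (j1 ^ 2 - x ^ 2) / (j1 ^ 2 + x ^ 2) ∧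
      ((j1 ^ 2 + x ^ 2) / (j1 ^ 2 - x ^ 2)) ^ ((1 : ℝ) / (ν + 2)) ≤
        Jcal (ν + 1) x / Jcal ν x := by
  have ha : 0 < ν + 1 := by linarith
  have ha1 : 0 < ν + 1 + 1 := by linarith
  have hT : 0 < j1 ^ 2 := by positivity
  have fpos : ∀ t, 0 ≤ t → t < j1 ^ 2 → 0 < auxF (ν + 1) t := by
    intro t h0 h1
    by_contra hc
    push Not at hc
    have hcont : ContinuousOn (auxF (ν + 1)) (Icc 0 t) := fun s _ =>
      (auxF_hasDerivAt ha s).continuousAt.continuousWithinAt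
    obtain ⟨s, hs, hs0⟩ := intermediate_value_Icc' h0 hcont
      (show (0 : ℝ) ∈ Icc (auxF (ν + 1) t) (auxF (ν + 1) 0) from ⟨hc, by
        rw [auxF_zero ha]; norm_num⟩)
    have hsp : 0 < s := by
      rcases hs.1.eq_or_lt with h | h
      · rw [← h, auxF_zero ha] at hs0; norm_num at hs0
      · exact h
    have h2 := hj1min (√s) (Real.sqrt_pos.2 hsp) (by
      rw [Jcal_eq_auxF, Real.sq_sqrt hs.1, hs0])
    have h3 := Real.sq_sqrt hs.1
    have h4 := pow_le_pow_left₀ hj1pos.le h2 2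
    linarith [hs.2]
  intro x hx
  have hxT : x ^ 2 < j1 ^ 2 := by
    rw [← sq_abs x]; exact pow_lt_pow_left₀ hx (abs_nonneg x) two_ne_zero
  have hg' : ∀ t, t * (-(1 / (4 * (ν + 1 + 1))) * auxF (ν + 1 + 1 + 1) t)
      = (ν + 1) * (auxF (ν + 1) t - auxF (ν + 1 + 1) t) := by
    intro t
    have h := auxF_rec ha t
    rw [show ν + 1 + 2 = ν + 1 + 1 + 1 by ring] at h
    field_simp at h ⊢
    linear_combination h
  obtain ⟨h1, h2, h3⟩ := aux_main ha hT hj1sq (auxF_hasDerivAt ha) (auxF_hasDerivAt ha1) hg'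
    (auxF_zero ha) (auxF_zero ha1) (by rw [← Jcal_eq_auxF, hj1zero]) fpos (sq_nonneg x) hxT
  have hf := fpos _ (sq_nonneg x) hxT
  rw [Jcal_eq_auxF, Jcal_eq_auxF]
  refine ⟨h1, ?_⟩
  have hm : 0 < j1 ^ 2 - x ^ 2 := by linarith
  have hp : 0 < j1 ^ 2 + x ^ 2 := by positivity
  have hlog := Real.log_le_log hf h1
  rw [Real.log_div hm.ne' hp.ne'] at hlog
  rw [← Real.log_le_log_iff (by positivity) (by positivity), Real.log_rpow (by positivity),
    Real.log_div hp.ne' hm.ne', Real.log_div h2.ne' hf.ne', show ν + 2 = ν + 1 + 1 by ring,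
    div_mul_eq_mul_div, one_mul, div_le_iff₀ ha1]
  linarith
end
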